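/- arXiv:2410.07897 — 6 statements merged into one kernel-verified Lean document; each statement's English description precedes it below -/
import Mathlib

section
/- Let G be an r×n matrix over 𝔽_2² whose rows g_1,...,g_r are nonzero and 𝔽_2-independent (the only combination of rows summing to 0 is the trivial one), and suppose G is an LR-matrix (is in trellis-oriented form): for every index t ∈ {1,...,n}, at most two rows have left index t, and if two distinct rows g_i, g_j have the same left index t then g_{i,t} ≠ g_{j,t}; and the same condition holds for right indices. For each row g_i let T(g_i) be a reduced biproper trellis presenting the two-word code {0, g_i} (the atomic trellis). Then the Shannon product T(g_1) × T(g_2) × ... × T(g_r) is a reduced biproper trellis presenting the group code generated by the rows of G, and hence is the minimal trellis of this code. -/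
/-- A trellis of depth `n` over the alphabet `A`.  The vertex classes are
`V 0, …, V n` (classes `V t` for `t > n` are irrelevant junk), every edge of the
`t`-th section goes from `V t` to `V (t+1)` and carries a label in `A`, and
`V 0` consists of the single root vertex. -/
structure Trellis (A : Type) (n : ℕ) : Type 1 where
  V : ℕ → Type
  instFin : ∀ t, Fintype (V t)
  instDec : ∀ t, DecidableEq (V t)
  root : V 0
  root_unique : ∀ v : V 0, v = root
  E : ∀ t : ℕ, Finset (V t × V (t + 1) × A)

attribute [instance] Trellis.instFin Trellis.instDec

namespace Trellis

variable {A : Type} {n : ℕ}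

/-- A path of a trellis: a sequence of `n` consecutive edges starting at the root
(the start vertex is automatically the root since `V 0` is a singleton). -/
structure Path (T : Trellis A n) where
  vert : ∀ t : ℕ, t ≤ n → T.V t
  label : Fin n → A
  mem : ∀ (t : ℕ) (h : t < n),
    (vert t h.le, vert (t + 1) h, label ⟨t, h⟩) ∈ T.E t

/-- The set of words of paths of `T`. -/
def Words (T : Trellis A n) : Set (Fin n → A) := {w | ∃ p : T.Path, p.label = w}

/-- The set of words of paths of `T` ending at the goal vertex `g ∈ V n`. -/
def WordsTo (T : Trellis A n) (g : T.V n) : Set (Fin n → A) :=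
  {w | ∃ p : T.Path, p.vert n (le_refl n) = g ∧ p.label = w}

/-- `T` has a single goal vertex. -/
def SingleGoal (T : Trellis A n) : Prop := ∀ v w : T.V n, v = w

/-- `T` is a (single-goal) trellis presenting the block code `C`. -/
def Presents (T : Trellis A n) (C : Set (Fin n → A)) : Prop :=
  T.SingleGoal ∧ T.Words = C

/-- Every vertex of `T` lies on some path. -/
def Reduced (T : Trellis A n) : Prop :=
  ∀ (t : ℕ) (h : t ≤ n) (v : T.V t), ∃ p : T.Path, p.vert t h = v

/-- `T` has no right twins and no left twins. -/
def Biproper (T : Trellis A n) : Prop :=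
  (∀ t, t < n → ∀ (u : T.V t) (v v' : T.V (t + 1)) (a : A),
      (u, v, a) ∈ T.E t → (u, v', a) ∈ T.E t → v = v') ∧
  (∀ t, t < n → ∀ (u u' : T.V t) (v : T.V (t + 1)) (a : A),
      (u, v, a) ∈ T.E t → (u', v, a) ∈ T.E t → u = u')

/-- Total number of vertices of `T` (vertex classes `0,…,n`). -/
def vertCard (T : Trellis A n) : ℕ := ∑ t ∈ Finset.range (n + 1), Fintype.card (T.V t)

/-- Total number of edges of `T` (sections `1,…,n`). -/
def edgeCard (T : Trellis A n) : ℕ := ∑ t ∈ Finset.range n, (T.E t).card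

/-- An isomorphism of trellises: bijections of the vertex classes preserving
the edges together with their labels. -/
structure Iso (T T' : Trellis A n) where
  equiv : ∀ t : ℕ, t ≤ n → (T.V t ≃ T'.V t)
  mem_iff : ∀ (t : ℕ) (h : t < n) (u : T.V t) (v : T.V (t + 1)) (a : A),
    (u, v, a) ∈ T.E t ↔ (equiv t h.le u, equiv (t + 1) h v, a) ∈ T'.E t

/-- `T` is a minimal trellis presenting `C`. -/
def MinimalFor (T : Trellis A n) (C : Set (Fin n → A)) : Prop :=
  T.Presents C ∧ ∀ T' : Trellis A n, T'.Presents C → T.vertCard ≤ T'.vertCard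

/-- A multi-goal trellis `T` represents the joint code with subcode list `Cs`
if the goal vertices can be indexed by `ι` in such a way that the sub-trellis
of the `i`-th goal vertex presents `Cs i`. -/
def Represents {ι : Type} (T : Trellis A n) (Cs : ι → Set (Fin n → A)) : Prop :=
  ∃ φ : ι ≃ T.V n, ∀ i, T.WordsTo (φ i) = Cs i

/-- `T` is a minimal multi-goal trellis representing the joint code `Cs`. -/
def MinimalRep {ι : Type} (T : Trellis A n) (Cs : ι → Set (Fin n → A)) : Prop :=
  T.Represents Cs ∧ ∀ T' : Trellis A n, T'.Represents Cs → T.vertCard ≤ T'.vertCard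

end Trellis

/-- A block code `C ⊆ A^n` is rectangular if for every `t ∈ {1,…,n-1}`,
whenever `(a,c), (a,d), (b,c) ∈ C` (splitting words into length-`t` prefixes
and length-`(n-t)` suffixes), then also `(b,d) ∈ C`.  Here `w1 = (a,c)`,
`w2 = (a,d)`, `w3 = (b,c)` and the conclusion is `(b,d) ∈ C`. -/
def Rectangular {A : Type} {n : ℕ} (C : Set (Fin n → A)) : Prop :=
  ∀ t : ℕ, 1 ≤ t → t < n → ∀ w1 w2 w3 : Fin n → A,
    w1 ∈ C → w2 ∈ C → w3 ∈ C →
    (∀ i : Fin n, (i : ℕ) < t → w1 i = w2 i) →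
    (∀ i : Fin n, t ≤ (i : ℕ) → w1 i = w3 i) →
    (fun i : Fin n => if (i : ℕ) < t then w3 i else w2 i) ∈ C

/-- The Shannon product of two trellises over an additively written abelian
group alphabet: vertex classes are the products of the vertex classes, and each
pair of `t`-th-section edges `(v'₁, v'₂, a')`, `(v''₁, v''₂, a'')` yields the
edge `((v'₁,v''₁), (v'₂,v''₂), a' + a'')`. -/
def Trellis.shannonProd {A : Type} [AddCommGroup A] [DecidableEq A] {n : ℕ}
    (T T' : Trellis A n) : Trellis A n where
  V := fun t => T.V t × T'.V t
  instFin := fun _ => inferInstance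
  instDec := fun _ => inferInstance
  root := (T.root, T'.root)
  root_unique := fun v => by
    obtain ⟨a, b⟩ := v
    rw [T.root_unique a, T'.root_unique b]
  E := fun t =>
    (T.E t ×ˢ T'.E t).image
      (fun e => ((e.1.1, e.2.1), (e.1.2.1, e.2.2.1), e.1.2.2 + e.2.2.2))

/-- The trivial one-path trellis presenting the code `{0}`. -/
def Trellis.zeroTrellis (A : Type) [AddCommGroup A] (n : ℕ) : Trellis A n where
  V := fun _ => PUnit
  instFin := fun _ => inferInstance
  instDec := fun _ => inferInstance
  root := PUnit.unit
  root_unique := fun _ => rfl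
  E := fun _ => {(PUnit.unit, PUnit.unit, 0)}

/-- The effective single-qubit Pauli group, identified with the additive group
`𝔽₂²` via `I ↔ (0,0)`, `X ↔ (1,0)`, `Z ↔ (0,1)`, `Y ↔ (1,1)`. -/
abbrev Pauli : Type := ZMod 2 × ZMod 2

/-- `t` is the left index of `g`: the least position where `g` is nonzero. -/
def IsLeftIndex {n : ℕ} (g : Fin n → Pauli) (t : Fin n) : Prop :=
  g t ≠ 0 ∧ ∀ s : Fin n, s < t → g s = 0

/-- `t` is the right index of `g`: the greatest position where `g` is nonzero. -/
def IsRightIndex {n : ℕ} (g : Fin n → Pauli) (t : Fin n) : Prop :=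
  g t ≠ 0 ∧ ∀ s : Fin n, t < s → g s = 0

/-- The matrix with rows `G i` has the L-property: for every index `t`, at most
two rows have left index `t`, and two distinct rows sharing the left index `t`
have different entries at `t`. -/
def LProperty {r n : ℕ} (G : Fin r → Fin n → Pauli) : Prop :=
  (∀ (t : Fin n) (i j : Fin r), i ≠ j →
      IsLeftIndex (G i) t → IsLeftIndex (G j) t → G i t ≠ G j t) ∧
  (∀ (t : Fin n) (i j l : Fin r), i ≠ j → i ≠ l → j ≠ l →
      IsLeftIndex (G i) t → IsLeftIndex (G j) t → ¬ IsLeftIndex (G l) t)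

/-- The matrix with rows `G i` has the R-property (same condition for right
indices). -/
def RProperty {r n : ℕ} (G : Fin r → Fin n → Pauli) : Prop :=
  (∀ (t : Fin n) (i j : Fin r), i ≠ j →
      IsRightIndex (G i) t → IsRightIndex (G j) t → G i t ≠ G j t) ∧
  (∀ (t : Fin n) (i j l : Fin r), i ≠ j → i ≠ l → j ≠ l →
      IsRightIndex (G i) t → IsRightIndex (G j) t → ¬ IsRightIndex (G l) t)

/-- `G` is an LR-matrix (is in trellis-oriented form). -/
def LRMatrix {r n : ℕ} (G : Fin r → Fin n → Pauli) : Prop :=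
  LProperty G ∧ RProperty G

namespace Trellis

section General

variable {A : Type} {n : ℕ} {T : Trellis A n}

/-- Splicing two paths along an edge of section `t`. -/
theorem Path.exists_splice (p q : T.Path) {t : ℕ} (ht : t < n) {b : A}
    (hb : (p.vert t ht.le, q.vert (t + 1) ht, b) ∈ T.E t) :
    ∃ s : T.Path, s.label ⟨t, ht⟩ = b ∧ (∀ i : Fin n, (i : ℕ) < t → s.label i = p.label i) ∧
      ∀ i : Fin n, t < (i : ℕ) → s.label i = q.label i := by
  refine ⟨⟨fun s hs => if s ≤ t then p.vert s hs else q.vert s hs,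
    fun i => if (i : ℕ) < t then p.label i else if (i : ℕ) = t then b else q.label i, ?_⟩,
    ?_, ?_, ?_⟩
  · intro s hs
    rcases lt_trichotomy s t with h | rfl | h
    · simpa [h, h.le, Nat.succ_le_of_lt h] using p.mem s hs
    · simpa using hb
    · simpa [h.not_ge, h.not_gt, h.ne', show ¬ s + 1 ≤ t by omega] using q.mem s hs
  · simp
  · intro i hi
    simp [hi]
  · intro i hi
    simp [hi.not_gt, hi.ne']

theorem Path.exists_splice_of_vert_eq (p q : T.Path) {t : ℕ} (ht : t ≤ n)
    (h : p.vert t ht = q.vert t ht) :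
    ∃ s : T.Path, (∀ i : Fin n, (i : ℕ) < t → s.label i = p.label i) ∧
      ∀ i : Fin n, t ≤ (i : ℕ) → s.label i = q.label i := by
  rcases ht.lt_or_eq with hlt | rfl
  · obtain ⟨s, hs, hl, hr⟩ := p.exists_splice q hlt (b := q.label ⟨t, hlt⟩)
      (h ▸ q.mem t hlt)
    refine ⟨s, hl, fun i hi => ?_⟩
    rcases hi.lt_or_eq with hi | rfl
    · exact hr i hi
    · exact hs
  · exact ⟨p, fun _ _ => rfl, fun i hi => absurd i.2 hi.not_gt⟩

theorem Biproper.vert_eq_of_prefix (hT : T.Biproper) (p q : T.Path) :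
    ∀ (t : ℕ) (ht : t ≤ n), (∀ i : Fin n, (i : ℕ) < t → p.label i = q.label i) →
      p.vert t ht = q.vert t ht := by
  intro t
  induction t with
  | zero => intro _ _; rw [T.root_unique (p.vert 0 _), T.root_unique (q.vert 0 _)]
  | succ t ih =>
    intro ht h
    have hv := ih (Nat.le_of_succ_le ht) fun i hi => h i (by omega)
    refine hT.1 t ht _ _ _ _ (p.mem t ht) ?_
    rw [hv, h ⟨t, ht⟩ t.lt_succ_self]
    exact q.mem t ht

theorem Biproper.vert_eq_of_suffix (hT : T.Biproper) (hg : T.SingleGoal) (p q : T.Path)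
    (t : ℕ) (ht : t ≤ n) :
    (∀ i : Fin n, t ≤ (i : ℕ) → p.label i = q.label i) → p.vert t ht = q.vert t ht := by
  induction ht using Nat.decreasingInduction with
  | self => exact fun _ => hg _ _
  | of_succ t ht ih =>
    intro h
    have hv := ih fun i hi => h i (by omega)
    refine hT.2 t ht _ _ _ _ (p.mem t ht) ?_
    rw [hv, h ⟨t, ht⟩ le_rfl]
    exact q.mem t ht

/-- A reduced biproper trellis has the least possible number of vertices at every depth. -/
theorem card_vert_le {C : Set (Fin n → A)} (hC : T.Presents C) (hr : T.Reduced)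
    (hb : T.Biproper) {T' : Trellis A n} (hC' : T'.Presents C) {t : ℕ} (ht : t ≤ n) :
    Fintype.card (T.V t) ≤ Fintype.card (T'.V t) := by
  choose p hp using hr t ht
  have hq : ∀ v, ∃ q : T'.Path, q.label = (p v).label := fun v => by
    have : (p v).label ∈ T'.Words := by
      rw [hC'.2, ← hC.2]
      exact ⟨p v, rfl⟩
    exact this
  choose q hq using hq
  refine Fintype.card_le_of_injective (fun v => (q v).vert t ht) fun v w hvw => ?_
  obtain ⟨s, hsl, hsr⟩ := (q v).exists_splice_of_vert_eq (q w) ht hvw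
  have hs : s.label ∈ T.Words := by
    rw [hC.2, ← hC'.2]
    exact ⟨s, rfl⟩
  obtain ⟨x, hx⟩ := hs
  rw [← hp v, ← hp w]
  trans x.vert t ht
  · exact hb.vert_eq_of_prefix _ _ t ht fun i hi => by rw [hx, hsl i hi, hq]
  · exact hb.vert_eq_of_suffix hC.1 _ _ t ht fun i hi => by rw [hx, hsr i hi, hq]

theorem Presents.minimalFor {C : Set (Fin n → A)} (hC : T.Presents C) (hr : T.Reduced)
    (hb : T.Biproper) : T.MinimalFor C :=
  ⟨hC, fun _ hC' => Finset.sum_le_sum fun _ ht =>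
    card_vert_le hC hr hb hC' (Nat.le_of_lt_succ (Finset.mem_range.1 ht))⟩

end General

section Product

variable {A : Type} [AddCommGroup A] {n : ℕ}

/-- `P` is, up to relabelling of its vertices, the Shannon product of the family `T`. -/
def IsShannonProd {ι : Type} [Fintype ι] (P : Trellis A n) (T : ι → Trellis A n) : Prop :=
  ∃ e : ∀ t, P.V t ≃ ∀ i, (T i).V t, ∀ t u v a, (u, v, a) ∈ P.E t ↔
    ∃ b : ι → A, (∀ i, (e t u i, e (t + 1) v i, b i) ∈ (T i).E t) ∧ ∑ i, b i = a

theorem isShannonProd_zeroTrellis (T : Fin 0 → Trellis A n) :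
    IsShannonProd (zeroTrellis A n) T := by
  refine ⟨fun _ => Equiv.ofUnique PUnit _, fun t u v a => ⟨fun h => ?_, ?_⟩⟩
  · cases Finset.mem_singleton.1 h
    exact ⟨0, fun i => i.elim0, Fintype.sum_empty _⟩
  · rintro ⟨b, -, rfl⟩
    rw [Fintype.sum_empty]
    exact Finset.mem_singleton_self _

variable [DecidableEq A]

theorem IsShannonProd.cons {r : ℕ} {P : Trellis A n} {T : Fin (r + 1) → Trellis A n}
    (h : IsShannonProd P fun i : Fin r => T i.succ) : IsShannonProd ((T 0).shannonProd P) T := by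
  obtain ⟨e, he⟩ := h
  refine ⟨fun t => ((Equiv.refl _).prodCongr (e t)).trans (Fin.consEquiv fun i => (T i).V t),
    ?_⟩
  rintro t ⟨u₀, u⟩ ⟨v₀, v⟩ a
  constructor
  · intro h
    obtain ⟨⟨⟨u₁, v₁, a₁⟩, ⟨u₂, v₂, a₂⟩⟩, hm, heq⟩ := Finset.mem_image.1 h
    obtain ⟨h₁, h₂⟩ := Finset.mem_product.1 hm
    obtain ⟨b, hb, hs⟩ := (he _ _ _ _).1 h₂
    cases heq
    refine ⟨Fin.cons a₁ b, Fin.cases h₁ hb, ?_⟩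
    rw [Fin.sum_univ_succ]
    simp [hs]
  · rintro ⟨b, hb, hs⟩
    refine Finset.mem_image.2 ⟨((u₀, v₀, b 0), (u, v, ∑ i : Fin r, b i.succ)),
      Finset.mem_product.2 ⟨hb 0, (he _ _ _ _).2 ⟨_, fun i => hb i.succ, rfl⟩⟩, ?_⟩
    rw [← hs, Fin.sum_univ_succ]
    rfl

theorem isShannonProd_foldr :
    ∀ {r : ℕ} (T : Fin r → Trellis A n),
      IsShannonProd ((List.ofFn T).foldr shannonProd (zeroTrellis A n)) T
  | 0, T => by simpa using isShannonProd_zeroTrellis T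
  | r + 1, T => by
    rw [List.ofFn_succ, List.foldr_cons]
    exact (isShannonProd_foldr _).cons

end Product

namespace IsShannonProd

variable {A : Type} [AddCommGroup A] {n : ℕ} {ι : Type} [Fintype ι] {P : Trellis A n}
  {T : ι → Trellis A n}

theorem singleGoal (hP : IsShannonProd P T) (h : ∀ i, (T i).SingleGoal) : P.SingleGoal := by
  obtain ⟨e, -⟩ := hP
  exact fun v w => (e n).injective (funext fun i => h i _ _)

theorem reduced (hP : IsShannonProd P T) (h : ∀ i, (T i).Reduced) : P.Reduced := by
  obtain ⟨e, he⟩ := hP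
  intro t ht v
  choose p hp using fun i => h i t ht (e t v i)
  refine ⟨⟨fun s hs => (e s).symm fun i => (p i).vert s hs, fun k => ∑ i, (p i).label k,
    fun s hs => (he _ _ _ _).2 ⟨fun i => (p i).label ⟨s, hs⟩, fun i => ?_, rfl⟩⟩, ?_⟩
  · simpa using (p i).mem s hs
  · simp [hp]

theorem mem_words_iff (hP : IsShannonProd P T) (w : Fin n → A) :
    w ∈ P.Words ↔ ∃ c : ι → Fin n → A, (∀ i, c i ∈ (T i).Words) ∧ ∑ i, c i = w := by
  obtain ⟨e, he⟩ := hP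
  constructor
  · rintro ⟨p, rfl⟩
    choose b hb hs using fun k : Fin n => (he _ _ _ _).1 (p.mem k k.2)
    refine ⟨fun i k => b k i, fun i => ⟨⟨fun s hs => e s (p.vert s hs) i, fun k => b k i,
      fun s hs => hb ⟨s, hs⟩ i⟩, rfl⟩, ?_⟩
    ext1 k
    simpa using hs k
  · rintro ⟨c, hc, rfl⟩
    choose p hp using hc
    refine ⟨⟨fun s hs => (e s).symm fun i => (p i).vert s hs, ∑ i, c i,
      fun s hs => (he _ _ _ _).2 ⟨fun i => c i ⟨s, hs⟩, fun i => ?_, by simp⟩⟩, rfl⟩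
    simpa [hp] using (p i).mem s hs

end IsShannonProd

end Trellis

theorem exists_sum_mem_pair_iff {M ι : Type*} [AddCommGroup M] [Fintype ι]
    (h2 : ∀ x : M, x + x = 0) (g : ι → M) (w : M) :
    (∃ c : ι → M, (∀ i, c i ∈ ({0, g i} : Set M)) ∧ ∑ i, c i = w) ↔
      w ∈ AddSubgroup.closure (Set.range g) := by
  classical
  constructor
  · rintro ⟨c, hc, rfl⟩
    refine sum_mem fun i _ => ?_
    rcases hc i with h | h
    · rw [h]
      exact zero_mem _
    · rw [h]
      exact AddSubgroup.subset_closure ⟨i, rfl⟩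
  · intro hw
    induction hw using AddSubgroup.closure_induction with
    | mem x hx =>
      obtain ⟨i, rfl⟩ := hx
      refine ⟨Pi.single i (g i), fun j => ?_, by simp⟩
      by_cases h : j = i
      · subst h
        simp
      · simp [h]
    | zero => exact ⟨0, fun i => Or.inl rfl, by simp⟩
    | add x y _ _ hx hy =>
      obtain ⟨c, hc, rfl⟩ := hx
      obtain ⟨d, hd, rfl⟩ := hy
      refine ⟨c + d, fun i => ?_, by simp [Finset.sum_add_distrib]⟩
      rcases hc i with h | h <;> rcases hd i with h' | h' <;> simp_all
    | neg x _ hx => rwa [neg_eq_of_add_eq_zero_left (h2 x)]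

theorem eq_zero_of_sum_eq_zero_of_support_le_two {M ι : Type*} [AddCommGroup M] [Fintype ι]
    (h2 : ∀ x : M, x + x = 0) (c : ι → M)
    (hne : ∀ i j, i ≠ j → c i ≠ 0 → c j ≠ 0 → c i ≠ c j)
    (htwo : ∀ i j l, i ≠ j → i ≠ l → j ≠ l → c i ≠ 0 → c j ≠ 0 → c l = 0)
    (hsum : ∑ i, c i = 0) : c = 0 := by
  classical
  by_contra hc
  obtain ⟨i, hi⟩ := Function.ne_iff.1 hc
  by_cases hj : ∃ j, i ≠ j ∧ c j ≠ 0
  · obtain ⟨j, hij, hj⟩ := hj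
    rw [Fintype.sum_eq_add i j hij fun l hl =>
      htwo i j l hij hl.1.symm hl.2.symm hi hj] at hsum
    exact hne i j hij hi hj (add_right_cancel (hsum.trans (h2 (c j)).symm))
  · push Not at hj
    rw [Fintype.sum_eq_single i fun j hji => hj j hji.symm] at hsum
    exact hi hsum

namespace Trellis

variable {n : ℕ} {g : Fin n → Pauli} {T : Trellis Pauli n}

theorem isLeftIndex_of_edges (hT : T.Presents {0, g}) (hr : T.Reduced) {t : ℕ} (ht : t < n)
    {u : T.V t} {v v' : T.V (t + 1)} {b b' : Pauli} (h : (u, v, b) ∈ T.E t)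
    (h' : (u, v', b') ∈ T.E t) (hbb : b ≠ b') :
    IsLeftIndex g ⟨t, ht⟩ ∧ b + b' = g ⟨t, ht⟩ := by
  obtain ⟨p, rfl⟩ := hr t ht.le u
  obtain ⟨q, rfl⟩ := hr (t + 1) ht v
  obtain ⟨q', rfl⟩ := hr (t + 1) ht v'
  obtain ⟨s, rfl, hs, -⟩ := p.exists_splice q ht h
  obtain ⟨s', rfl, hs', -⟩ := p.exists_splice q' ht h'
  have hw : s.label ∈ ({0, g} : Set _) := hT.2 ▸ ⟨s, rfl⟩
  have hw' : s'.label ∈ ({0, g} : Set _) := hT.2 ▸ ⟨s', rfl⟩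
  have heq : ∀ i : Fin n, i < ⟨t, ht⟩ → s.label i = s'.label i := fun i hi =>
    (hs i hi).trans (hs' i hi).symm
  rcases hw with hw | hw <;> rcases hw' with hw' | hw' <;> rw [hw, hw'] at hbb heq ⊢
  · exact absurd rfl hbb
  · exact ⟨⟨hbb.symm, fun i hi => (heq i hi).symm⟩, zero_add _⟩
  · exact ⟨⟨hbb, heq⟩, add_zero _⟩
  · exact absurd rfl hbb

theorem isRightIndex_of_edges (hT : T.Presents {0, g}) (hr : T.Reduced) {t : ℕ} (ht : t < n)
    {u u' : T.V t} {v : T.V (t + 1)} {b b' : Pauli} (h : (u, v, b) ∈ T.E t)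
    (h' : (u', v, b') ∈ T.E t) (hbb : b ≠ b') :
    IsRightIndex g ⟨t, ht⟩ ∧ b + b' = g ⟨t, ht⟩ := by
  obtain ⟨p, rfl⟩ := hr t ht.le u
  obtain ⟨p', rfl⟩ := hr t ht.le u'
  obtain ⟨q, rfl⟩ := hr (t + 1) ht v
  obtain ⟨s, rfl, -, hs⟩ := p.exists_splice q ht h
  obtain ⟨s', rfl, -, hs'⟩ := p'.exists_splice q ht h'
  have hw : s.label ∈ ({0, g} : Set _) := hT.2 ▸ ⟨s, rfl⟩
  have hw' : s'.label ∈ ({0, g} : Set _) := hT.2 ▸ ⟨s', rfl⟩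
  have heq : ∀ i : Fin n, ⟨t, ht⟩ < i → s.label i = s'.label i := fun i hi =>
    (hs i hi).trans (hs' i hi).symm
  rcases hw with hw | hw <;> rcases hw' with hw' | hw' <;> rw [hw, hw'] at hbb heq ⊢
  · exact absurd rfl hbb
  · exact ⟨⟨hbb.symm, fun i hi => (heq i hi).symm⟩, zero_add _⟩
  · exact ⟨⟨hbb, heq⟩, add_zero _⟩
  · exact absurd rfl hbb

end Trellis

theorem Pauli.add_self (x : Pauli) : x + x = 0 := CharTwo.add_self_eq_zero x

/-- Two families of labels with the same sum coincide if they differ only in at most two places,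
where their differences are distinct. -/
theorem Pauli.eq_of_sum_eq {ι : Type} [Fintype ι] {b b' d : ι → Pauli} (Q : ι → Prop)
    (hQ : ∀ i, b i ≠ b' i → Q i ∧ b i + b' i = d i)
    (hne : ∀ i j, i ≠ j → Q i → Q j → d i ≠ d j)
    (htwo : ∀ i j l, i ≠ j → i ≠ l → j ≠ l → Q i → Q j → ¬ Q l)
    (hsum : ∑ i, b i = ∑ i, b' i) : b = b' := by
  have hnz : ∀ i, (b + b') i ≠ 0 → b i ≠ b' i := fun i hi h =>
    hi (by rw [Pi.add_apply, h, Pauli.add_self])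
  have h0 : b + b' = 0 := by
    refine eq_zero_of_sum_eq_zero_of_support_le_two Pauli.add_self _ ?_ ?_ ?_
    · intro i j hij hi hj
      obtain ⟨qi, di⟩ := hQ i (hnz i hi)
      obtain ⟨qj, dj⟩ := hQ j (hnz j hj)
      rw [Pi.add_apply, Pi.add_apply, di, dj]
      exact hne i j hij qi qj
    · intro i j l hij hil hjl hi hj
      by_contra hl
      exact htwo i j l hij hil hjl (hQ i (hnz i hi)).1 (hQ j (hnz j hj)).1 (hQ l (hnz l hl)).1
    · simp only [Pi.add_apply]
      rw [Finset.sum_add_distrib, hsum, Pauli.add_self]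
  funext i
  exact add_right_cancel ((congrFun h0 i).trans (Pauli.add_self (b' i)).symm)

theorem Trellis.IsShannonProd.biproper {r n : ℕ} {G : Fin r → Fin n → Pauli} (hLR : LRMatrix G)
    {P : Trellis Pauli n} {T : Fin r → Trellis Pauli n} (hP : IsShannonProd P T)
    (hT : ∀ i, (T i).Presents {0, G i}) (hr : ∀ i, (T i).Reduced) (hb : ∀ i, (T i).Biproper) :
    P.Biproper := by
  obtain ⟨e, he⟩ := hP
  constructor
  · intro t ht u v v' a h h'
    obtain ⟨b, hbm, rfl⟩ := (he _ _ _ _).1 h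
    obtain ⟨b', hbm', hs⟩ := (he _ _ _ _).1 h'
    obtain rfl := Pauli.eq_of_sum_eq (fun i => IsLeftIndex (G i) ⟨t, ht⟩)
      (fun i => isLeftIndex_of_edges (hT i) (hr i) ht (hbm i) (hbm' i))
      (hLR.1.1 _) (hLR.1.2 _) hs.symm
    exact (e _).injective (funext fun i => (hb i).1 t ht _ _ _ _ (hbm i) (hbm' i))
  · intro t ht u u' v a h h'
    obtain ⟨b, hbm, rfl⟩ := (he _ _ _ _).1 h
    obtain ⟨b', hbm', hs⟩ := (he _ _ _ _).1 h'
    obtain rfl := Pauli.eq_of_sum_eq (fun i => IsRightIndex (G i) ⟨t, ht⟩)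
      (fun i => isRightIndex_of_edges (hT i) (hr i) ht (hbm i) (hbm' i))
      (hLR.2.1 _) (hLR.2.2 _) hs.symm
    exact (e _).injective (funext fun i => (hb i).2 t ht _ _ _ _ (hbm i) (hbm' i))

/-- **Shannon product of atomic trellises yields the minimal trellis.**
Let `G` be an `r × n` matrix over `𝔽₂²` with nonzero, `𝔽₂`-independent rows
which is an LR-matrix (in trellis-oriented form), and for each row `G i` let
`Tat i` be a reduced biproper (i.e. minimal) trellis presenting the two-word
code `{0, G i}`.  Then the Shannon product of the trellises `Tat i` is a
reduced biproper trellis presenting the group code generated by the rows of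
`G`, and hence is the minimal trellis of this code. -/
theorem shannonProd_of_atomic_trellises_minimal
    {r n : ℕ} (G : Fin r → Fin n → Pauli)
    (hnz : ∀ i, G i ≠ 0)
    (hind : ∀ s : Finset (Fin r), ∑ i ∈ s, G i = 0 → s = ∅)
    (hLR : LRMatrix G)
    (Tat : Fin r → Trellis Pauli n)
    (hat : ∀ i, (Tat i).Presents {0, G i} ∧ (Tat i).Reduced ∧ (Tat i).Biproper) :
    ∀ Tp : Trellis Pauli n,
      Tp = (List.ofFn Tat).foldr Trellis.shannonProd (Trellis.zeroTrellis Pauli n) →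
      Tp.Presents (AddSubgroup.closure (Set.range G) : Set (Fin n → Pauli)) ∧
      Tp.Reduced ∧ Tp.Biproper ∧
      Tp.MinimalFor (AddSubgroup.closure (Set.range G) : Set (Fin n → Pauli)) := by
  intro Tp hTp
  have hP : Tp.IsShannonProd Tat := hTp ▸ Trellis.isShannonProd_foldr Tat
  have hpres : Tp.Presents (AddSubgroup.closure (Set.range G) : Set (Fin n → Pauli)) := by
    refine ⟨hP.singleGoal fun i => (hat i).1.1, Set.ext fun w => ?_⟩
    rw [hP.mem_words_iff, SetLike.mem_coe, ← exists_sum_mem_pair_iff fun x : Fin n → Pauli =>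
      funext fun k => Pauli.add_self (x k)]
    simp only [fun i => (hat i).1.2]
  have hred := hP.reduced fun i => (hat i).2.1
  have hbip := hP.biproper hLR (fun i => (hat i).1) (fun i => (hat i).2.1) fun i => (hat i).2.2
  exact ⟨hpres, hred, hbip, hpres.minimalFor hred hbip⟩
end

section
/- Let N ⊆ (𝔽_2²)^n be a subgroup, S ⊆ N a subgroup, and L ⊆ N a subgroup with N = L + S and L ∩ S = {0}, and let τ : L → (𝔽_2²)^m be an injective group homomorphism (the tail map). Define the extended code C^+ = {(ℓ + s, τ(ℓ)) : ℓ ∈ L, s ∈ S} ⊆ (𝔽_2²)^{n+m}. Then: (i) C^+ is a subgroup of (𝔽_2²)^{n+m} with |C^+| = |N|, and hence C^+ is a rectangular code; (ii) for any two codewords (w, τ(ℓ)) and (w', τ(ℓ')) of C^+, one has τ(ℓ) = τ(ℓ') if and only if w and w' lie in the same coset of S in N; in particular the tails of distinct cosets of S are distinct. -/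
/-- A subgroup of `A^n`, viewed as a block code, is rectangular. -/
theorem AddSubgroup.rectangular {A : Type} [AddCommGroup A] {n : ℕ}
    (H : AddSubgroup (Fin n → A)) : Rectangular (H : Set (Fin n → A)) := by
  intro t _ _ w1 w2 w3 h1 h2 h3 h12 h13
  have key : (fun i : Fin n => if (i : ℕ) < t then w3 i else w2 i) = w2 + w3 - w1 := by
    funext i
    by_cases hi : (i : ℕ) < t
    · simp [hi, h12 i hi]
    · simp [hi, h13 i (not_lt.mp hi)]
  rw [key]
  exact H.sub_mem (H.add_mem h2 h3) h1

/-- The sum map of two subgroups with trivial intersection is injective. -/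
theorem AddSubgroup.coprod_subtype_injective {G : Type*} [AddCommGroup G]
    {L S : AddSubgroup G} (h : Disjoint L S) :
    Function.Injective (L.subtype.coprod S.subtype) := by
  rw [injective_iff_map_eq_zero]
  rintro ⟨⟨l, hl⟩, ⟨s, hs⟩⟩ h0
  have h0' : l + s = 0 := by simpa using h0
  have hlS : l ∈ S := by
    rw [eq_neg_of_add_eq_zero_left h0']
    exact S.neg_mem hs
  have hl0 : l = 0 := AddSubgroup.disjoint_def.mp h hl hlS
  subst hl0
  have hs0 : s = 0 := by simpa using h0'
  subst hs0
  rfl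

/-- The encoder `(ℓ, s) ↦ (ℓ + s, τ ℓ)` appending the tail `τ ℓ` to a word of the coset of `ℓ`. -/
def tailEncoder {A : Type*} [AddCommGroup A] {n m : ℕ} (L S : AddSubgroup (Fin n → A))
    (τ : L →+ (Fin m → A)) : L × S →+ (Fin (n + m) → A) where
  toFun p := Fin.append ((p.1 : Fin n → A) + (p.2 : Fin n → A)) (τ p.1)
  map_zero' := by
    funext i
    refine Fin.addCases (fun j => ?_) (fun j => ?_) i <;> simp
  map_add' p q := by
    funext i
    refine Fin.addCases (fun j => ?_) (fun j => ?_) i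
    · simp [add_add_add_comm]
    · simp

theorem tailEncoder_injective {A : Type*} [AddCommGroup A] {n m : ℕ}
    {L S : AddSubgroup (Fin n → A)} (h : Disjoint L S) (τ : L →+ (Fin m → A)) :
    Function.Injective (tailEncoder L S τ) := by
  intro p q hpq
  apply AddSubgroup.coprod_subtype_injective h
  funext j
  simpa [tailEncoder] using congrFun hpq (Fin.castAdd m j)

theorem coe_range_tailEncoder {A : Type*} [AddCommGroup A] {n m : ℕ}
    (L S : AddSubgroup (Fin n → A)) (τ : L →+ (Fin m → A)) :
    ((tailEncoder L S τ).range : Set (Fin (n + m) → A)) =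
      {x | ∃ (ℓ : L) (s : S),
        x = Fin.append ((ℓ : Fin n → A) + (s : Fin n → A)) (τ ℓ)} := by
  ext x
  simp only [AddMonoidHom.coe_range, Set.mem_range, Prod.exists, Set.mem_ofPred_eq]
  exact exists_congr fun _ => exists_congr fun _ => eq_comm

theorem card_range_tailEncoder {A : Type*} [AddCommGroup A] {n m : ℕ}
    {L S : AddSubgroup (Fin n → A)} (h : Disjoint L S) (τ : L →+ (Fin m → A)) :
    Nat.card (tailEncoder L S τ).range = Nat.card (L ⊔ S : AddSubgroup (Fin n → A)) := by
  have hrange : (L.subtype.coprod S.subtype).range = L ⊔ S := by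
    ext x
    simp [AddSubgroup.mem_sup, AddMonoidHom.mem_range]
  rw [← hrange,
    ← Nat.card_congr (AddMonoidHom.ofInjective (tailEncoder_injective h τ)).toEquiv,
    ← Nat.card_congr
      (AddMonoidHom.ofInjective (AddSubgroup.coprod_subtype_injective h)).toEquiv]

/-- **The extended code of a joint code of cosets is a group code with distinct
tails.**  Let `S ≤ N` and `L ≤ N` be subgroups of `(𝔽₂²)^n` with `N = L + S`,
`L ∩ S = {0}`, and let `τ : L → (𝔽₂²)^m` be an injective homomorphism (the tail
map).  Let `C⁺ = {(ℓ+s, τ(ℓ)) : ℓ ∈ L, s ∈ S} ⊆ (𝔽₂²)^{n+m}`.  Then: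
(i) `C⁺` is a subgroup of `(𝔽₂²)^{n+m}` of the same cardinality as `N`, hence a
rectangular code; (ii) two codewords have the same tail iff their first parts
lie in the same coset of `S` in `N`. -/
theorem extended_joint_code_subgroup_rectangular_tails
    {n m : ℕ} (N S L : AddSubgroup (Fin n → Pauli))
    (hSN : S ≤ N) (hLN : L ≤ N) (hsup : L ⊔ S = N) (hinf : L ⊓ S = ⊥)
    (τ : ↥L →+ (Fin m → Pauli)) (hτ : Function.Injective τ) :
    (∃ H : AddSubgroup (Fin (n + m) → Pauli),
        (H : Set (Fin (n + m) → Pauli)) =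
          {x | ∃ (ℓ : L) (s : S),
            x = Fin.append ((ℓ : Fin n → Pauli) + (s : Fin n → Pauli)) (τ ℓ)} ∧
        Nat.card H = Nat.card N) ∧
    Rectangular
      {x : Fin (n + m) → Pauli | ∃ (ℓ : L) (s : S),
        x = Fin.append ((ℓ : Fin n → Pauli) + (s : Fin n → Pauli)) (τ ℓ)} ∧
    (∀ (ℓ ℓ' : L) (s s' : S),
      τ ℓ = τ ℓ' ↔
        ((ℓ : Fin n → Pauli) + (s : Fin n → Pauli)) -
          ((ℓ' : Fin n → Pauli) + (s' : Fin n → Pauli)) ∈ S) := by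
  have hdisj : Disjoint L S := disjoint_iff.mpr hinf
  refine ⟨⟨(tailEncoder L S τ).range, coe_range_tailEncoder L S τ, ?_⟩, ?_, ?_⟩
  · rw [card_range_tailEncoder hdisj, hsup]
  · rw [← coe_range_tailEncoder L S τ]
    exact AddSubgroup.rectangular _
  · intro ℓ ℓ' s s'
    rw [hτ.eq_iff, add_sub_add_comm,
      S.add_mem_cancel_right (S.sub_mem s.2 s'.2)]
    constructor
    · rintro rfl
      simp
    · intro h
      exact Subtype.ext
        (sub_eq_zero.mp (AddSubgroup.disjoint_def.mp hdisj (L.sub_mem ℓ.2 ℓ'.2) h))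
end

section
/- Let 0 ≤ k ≤ n and let S ⊆ (𝔽_2²)^n be a subgroup with |S| = 2^{n−k} that is isotropic for the symplectic pairing (s * s' = 0 for all s, s' ∈ S), and let N = {w ∈ (𝔽_2²)^n : w * s = 0 for all s ∈ S} be its symplectic complement, so that |N| = 2^{n+k} and S has exactly 2^{2k} cosets in N. Let T = (V, E) be the minimal multi-goal trellis representing the joint code 𝔑(N,S) whose underlying code is N and whose subcode list consists of the 2^{2k} cosets of S in N. Then |V| ≤ (5·2^{n+k} − 2^{2k} − 1)/3 < (5/3)·2^{n+k}, |E| ≤ (4/3)·(2^{n+k+1} − 2^{2k} − 1) < (8/3)·2^{n+k}, and 2|E| − |V| ≤ (11·2^{n+k} − 7·2^{2k} − 7)/3 < (11/3)·2^{n+k}. -/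
/-- The symplectic pairing `a * b = Σᵢ (aᵢ₁ bᵢ₂ + aᵢ₂ bᵢ₁)` on `(𝔽₂²)^n`. -/
def symplPair {n : ℕ} (a b : Fin n → Pauli) : ZMod 2 :=
  ∑ i, ((a i).1 * (b i).2 + (a i).2 * (b i).1)

/-! ### Summing along a walk with unit steps -/

lemma three_mul_sum_le_of_unit_steps {n k : ℕ} (hk : k ≤ n) (u : ℕ → ℕ) (h0 : u 0 = 0)
    (hn : u n = k) (hup : ∀ t < n, u (t + 1) ≤ u t + 1) (hdown : ∀ t < n, u t ≤ u (t + 1) + 1)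
    {c d : ℤ} (hd : 0 ≤ d) (hdc : d ≤ c) (hcd : c ≤ 4 * d) (hcd' : 3 * d ≤ 2 * c)
    (F : ℕ → ℤ)
    (hFeq : ∀ t < n, u t = u (t + 1) → F t ≤ d * 4 ^ u t)
    (hFup : ∀ t < n, u (t + 1) = u t + 1 → F t ≤ c * 4 ^ u t)
    (hFdown : ∀ t < n, u t = u (t + 1) + 1 → F t ≤ c * 4 ^ u (t + 1)) :
    3 * ∑ t ∈ Finset.range n, F t ≤ c * (2 * 2 ^ (n + k) - 2 ^ (2 * k) - 1) := by
  have hc : 0 ≤ c := hd.trans hdc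
  have hleft : ∀ t ≤ n, u t ≤ t := by
    intro t
    induction t with
    | zero => intro _; omega
    | succ t ih => intro h; have := hup t h; have := ih (by omega); omega
  have hright : ∀ j ≤ n, u (n - j) ≤ k + j := by
    intro j
    induction j with
    | zero => intro _; simp [hn]
    | succ j ih =>
      intro h
      have h1 := hdown (n - (j + 1)) (by omega)
      have h2 := ih (by omega)
      rw [show n - (j + 1) + 1 = n - j by omega] at h1
      omega
  have hpow : ∀ {a b : ℕ}, a ≤ b → c * (4 : ℤ) ^ a ≤ c * 4 ^ b := fun h =>
    mul_le_mul_of_nonneg_left (pow_le_pow_right₀ (by norm_num) h) hc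
  have hpow' : ∀ {a b : ℕ}, a ≤ b → d * (4 : ℤ) ^ a ≤ c * 4 ^ b := fun h =>
    mul_le_mul hdc (pow_le_pow_right₀ (by norm_num) h) (by positivity) hc
  have hF : ∀ t < n, ∀ b, (u t ≤ b ∨ u (t + 1) ≤ b) → F t ≤ c * 4 ^ b := by
    intro t ht b hb
    have h1 := hup t ht
    have h2 := hdown t ht
    rcases lt_trichotomy (u t) (u (t + 1)) with h | h | h
    · exact (hFup t ht (by omega)).trans (hpow (by omega))
    · exact (hFeq t ht h).trans (hpow' (by omega))
    · exact (hFdown t ht (by omega)).trans (hpow (by omega))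
  have hmid : ∀ t < n, ∀ b, u t ≤ b → u (t + 1) ≤ b → F t ≤ d * 4 ^ b := by
    have hquart : ∀ {a b : ℕ}, a + 1 ≤ b → c * (4 : ℤ) ^ a ≤ d * 4 ^ b := by
      intro a b h
      calc c * (4 : ℤ) ^ a ≤ (4 * d) * 4 ^ a := mul_le_mul_of_nonneg_right hcd (by positivity)
        _ = d * 4 ^ (a + 1) := by ring
        _ ≤ d * 4 ^ b := mul_le_mul_of_nonneg_left (pow_le_pow_right₀ (by norm_num) h) hd
    intro t ht b hb hb'
    have h1 := hup t ht
    have h2 := hdown t ht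
    rcases lt_trichotomy (u t) (u (t + 1)) with h | h | h
    · exact (hFup t ht (by omega)).trans (hquart (by omega))
    · exact (hFeq t ht h).trans
        (mul_le_mul_of_nonneg_left (pow_le_pow_right₀ (by norm_num) hb) hd)
    · exact (hFdown t ht (by omega)).trans (hquart (by omega))
  have hgeom : ∀ m : ℕ, 3 * ∑ t ∈ Finset.range m, (4 : ℤ) ^ t = 4 ^ m - 1 := by
    intro m
    have := geom_sum_mul (4 : ℤ) m
    linarith
  have hL : ∀ m ≤ n, 3 * ∑ t ∈ Finset.range m, F t ≤ c * (4 ^ m - 1) := by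
    intro m hm
    rw [← hgeom, ← mul_assoc, mul_comm c 3, mul_assoc, Finset.mul_sum _ _ c]
    refine mul_le_mul_of_nonneg_left (Finset.sum_le_sum fun t ht => ?_) (by norm_num)
    have := Finset.mem_range.mp ht
    exact hF t (by omega) t (Or.inl (hleft t (by omega)))
  have hR : ∀ m r, m + r = n →
      3 * ∑ t ∈ Finset.range r, F (m + t) ≤ c * (4 ^ (k + r) - 4 ^ k) := by
    intro m r hm
    have e1 : c * ((4 : ℤ) ^ (k + r) - 4 ^ k) =
        3 * ∑ t ∈ Finset.range r, c * 4 ^ (k + t) := by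
      simp only [pow_add, ← Finset.mul_sum]
      linear_combination (-c * 4 ^ k) * hgeom r
    rw [e1, ← Finset.sum_range_reflect]
    refine mul_le_mul_of_nonneg_left (Finset.sum_le_sum fun t ht => ?_) (by norm_num)
    have := Finset.mem_range.mp ht
    have h3 := hright t (by omega)
    refine hF _ (by omega) _ (Or.inr ?_)
    rwa [show m + (r - 1 - t) + 1 = n - t by omega]
  have h4 : (2 : ℤ) ^ (2 * k) = 4 ^ k := by rw [pow_mul]; norm_num
  rw [h4]
  rcases Nat.even_or_odd' (n - k) with ⟨r, hr | hr⟩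
  · have hs := Finset.sum_range_add F (k + r) r
    rw [show k + r + r = n by omega] at hs
    have h1 := hL (k + r) (by omega)
    have h2 := hR (k + r) r (by omega)
    have h5 : (2 : ℤ) ^ (n + k) = 4 ^ (k + r) := by
      rw [show n + k = 2 * (k + r) by omega, pow_mul]; norm_num
    rw [hs, h5]
    linarith
  · have hs := Finset.sum_range_add F (k + r + 1) r
    rw [show k + r + 1 + r = n by omega, Finset.sum_range_succ] at hs
    have h1 := hL (k + r) (by omega)
    have h2 := hR (k + r + 1) r (by omega)
    have h3 := hmid (k + r) (by omega) (k + r) (hleft _ (by omega)) (by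
      have := hright r (by omega)
      rwa [show n - r = k + r + 1 by omega] at this)
    have h5 : (2 : ℤ) ^ (n + k) = 2 * 4 ^ (k + r) := by
      rw [show n + k = 2 * (k + r) + 1 by omega, pow_succ, pow_mul]; norm_num; ring
    rw [hs, h5]
    have h6 : 3 * d * 4 ^ (k + r) ≤ 2 * c * 4 ^ (k + r) :=
      mul_le_mul_of_nonneg_right hcd' (by positivity)
    linarith

lemma complexity_bounds_of_unit_steps {n k : ℕ} (hk : k ≤ n) (u : ℕ → ℕ) (h0 : u 0 = 0)
    (hn : u n = k) (hup : ∀ t < n, u (t + 1) ≤ u t + 1) (hdown : ∀ t < n, u t ≤ u (t + 1) + 1)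
    {V E : ℤ} (hV : V = ∑ t ∈ Finset.range (n + 1), 2 ^ (2 * u t))
    (hE : E ≤ ∑ t ∈ Finset.range n, 2 ^ (1 + u t + u (t + 1))) :
    3 * V ≤ 5 * 2 ^ (n + k) - 2 ^ (2 * k) - 1 ∧
    3 * E ≤ 4 * (2 ^ (n + k + 1) - 2 ^ (2 * k) - 1) ∧
    3 * (2 * E - V) ≤ 11 * 2 ^ (n + k) - 7 * 2 ^ (2 * k) - 7 := by
  have hsq : ∀ a : ℕ, (2 : ℤ) ^ (2 * a) = 4 ^ a := fun a => by rw [pow_mul]; norm_num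
  have hprod : ∀ a b : ℕ, (2 : ℤ) ^ (1 + a + b) = 2 * (2 ^ a * 2 ^ b) := fun a b => by
    rw [pow_add, pow_add]; ring
  have hself : ∀ a : ℕ, (2 : ℤ) ^ a * 2 ^ a = 4 ^ a := fun a => by rw [← mul_pow]; norm_num
  have hVsum : 2 * V = 1 + 2 ^ (2 * k) +
      ∑ t ∈ Finset.range n, ((2 : ℤ) ^ (2 * u t) + 2 ^ (2 * u (t + 1))) := by
    have h1 := Finset.sum_range_succ (fun t => (2 : ℤ) ^ (2 * u t)) n
    have h2 := Finset.sum_range_succ' (fun t => (2 : ℤ) ^ (2 * u t)) n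
    rw [← hV] at h1 h2
    simp only [hn, h0, mul_zero, pow_zero] at h1 h2
    rw [Finset.sum_add_distrib]
    linarith
  have hv := three_mul_sum_le_of_unit_steps hk u h0 hn hup hdown (c := 5) (d := 2)
    (by norm_num) (by norm_num) (by norm_num) (by norm_num)
    (fun t => (2 : ℤ) ^ (2 * u t) + 2 ^ (2 * u (t + 1)))
    (fun t _ h => by simp only [← h, hsq]; linarith)
    (fun t _ h => by simp only [h, hsq, pow_succ]; linarith)
    (fun t _ h => by simp only [h, hsq, pow_succ]; linarith)
  have he := three_mul_sum_le_of_unit_steps hk u h0 hn hup hdown (c := 4) (d := 2)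
    (by norm_num) (by norm_num) (by norm_num) (by norm_num)
    (fun t => (2 : ℤ) ^ (1 + u t + u (t + 1)))
    (fun t _ h => by simp only [← h, hprod, hself]; linarith)
    (fun t _ h => by simp only [h, hprod, pow_succ]; linarith [hself (u t)])
    (fun t _ h => by simp only [h, hprod, pow_succ]; linarith [hself (u (t + 1))])
  have hev := three_mul_sum_le_of_unit_steps hk u h0 hn hup hdown (c := 11) (d := 6)
    (by norm_num) (by norm_num) (by norm_num) (by norm_num)
    (fun t => 4 * (2 : ℤ) ^ (1 + u t + u (t + 1)) - (2 ^ (2 * u t) + 2 ^ (2 * u (t + 1))))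
    (fun t _ h => by simp only [← h, hprod, hself, hsq]; linarith)
    (fun t _ h => by simp only [h, hprod, hsq, pow_succ]; linarith [hself (u t)])
    (fun t _ h => by simp only [h, hprod, hsq, pow_succ]; linarith [hself (u (t + 1))])
  rw [Finset.sum_sub_distrib, ← Finset.mul_sum] at hev
  refine ⟨by linarith, ?_, by linarith⟩
  rw [pow_succ]
  linarith

/-! ### Past and future subcodes -/

/-- The words supported on the coordinates `< t`. -/
def headWords (n t : ℕ) : Submodule (ZMod 2) (Fin n → Pauli) where
  carrier := {w | ∀ i : Fin n, t ≤ (i : ℕ) → w i = 0}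
  zero_mem' := fun _ _ => rfl
  add_mem' := fun hv hw i hi => by simp [hv i hi, hw i hi]
  smul_mem' := fun c w hw i hi => by simp [hw i hi]

/-- The words supported on the coordinates `≥ t`. -/
def tailWords (n t : ℕ) : Submodule (ZMod 2) (Fin n → Pauli) where
  carrier := {w | ∀ i : Fin n, (i : ℕ) < t → w i = 0}
  zero_mem' := fun _ _ => rfl
  add_mem' := fun hv hw i hi => by simp [hv i hi, hw i hi]
  smul_mem' := fun c w hw i hi => by simp [hw i hi]

lemma mem_headWords {n t : ℕ} {w : Fin n → Pauli} :
    w ∈ headWords n t ↔ ∀ i : Fin n, t ≤ (i : ℕ) → w i = 0 := Iff.rfl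

lemma mem_tailWords {n t : ℕ} {w : Fin n → Pauli} :
    w ∈ tailWords n t ↔ ∀ i : Fin n, (i : ℕ) < t → w i = 0 := Iff.rfl

lemma headWords_zero (n : ℕ) : headWords n 0 = ⊥ := by
  refine (Submodule.eq_bot_iff _).2 fun w hw => ?_
  funext i
  exact hw i (Nat.zero_le _)

lemma headWords_self (n : ℕ) : headWords n n = ⊤ :=
  eq_top_iff.2 fun _ _ i hi => absurd i.2 (by omega)

lemma tailWords_zero (n : ℕ) : tailWords n 0 = ⊤ :=
  eq_top_iff.2 fun _ _ _ hi => absurd hi (Nat.not_lt_zero _)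

lemma tailWords_self (n : ℕ) : tailWords n n = ⊥ := by
  refine (Submodule.eq_bot_iff _).2 fun w hw => ?_
  funext i
  exact hw i i.2

lemma headWords_mono (n : ℕ) {a b : ℕ} (h : a ≤ b) : headWords n a ≤ headWords n b :=
  fun _ hw i hi => hw i (h.trans hi)

lemma tailWords_anti (n : ℕ) {a b : ℕ} (h : a ≤ b) : tailWords n b ≤ tailWords n a :=
  fun _ hw i hi => hw i (hi.trans_le h)

lemma headWords_inf_tailWords (n : ℕ) {a b : ℕ} (h : a ≤ b) :
    headWords n a ⊓ tailWords n b = ⊥ := by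
  refine (Submodule.eq_bot_iff _).2 fun w hw => ?_
  funext i
  by_cases hi : (i : ℕ) < b
  · exact hw.2 i hi
  · exact hw.1 i (by omega)

lemma finrank_pauli : Module.finrank (ZMod 2) Pauli = 2 := by
  simp [Pauli]

lemma finrank_words (n : ℕ) : Module.finrank (ZMod 2) (Fin n → Pauli) = 2 * n := by
  rw [Module.finrank_pi_fintype]
  simp [mul_comm]

lemma finrank_inf_headWords_succ_le {n t : ℕ} (X : Submodule (ZMod 2) (Fin n → Pauli))
    (ht : t < n) :
    Module.finrank (ZMod 2) ↥(X ⊓ headWords n (t + 1)) ≤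
      Module.finrank (ZMod 2) ↥(X ⊓ headWords n t) + 2 := by
  let f : ↥(X ⊓ headWords n (t + 1)) →ₗ[ZMod 2] Pauli :=
    (LinearMap.proj (⟨t, ht⟩ : Fin n)).comp (Submodule.subtype _)
  have h1 := LinearMap.finrank_range_add_finrank_ker f
  have h2 : Module.finrank (ZMod 2) (LinearMap.range f) ≤ 2 :=
    (Submodule.finrank_le _).trans_eq finrank_pauli
  have h3 : Module.finrank (ZMod 2) (LinearMap.ker f) ≤
      Module.finrank (ZMod 2) ↥(X ⊓ headWords n t) := by
    rw [← Submodule.finrank_map_subtype_eq]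
    refine Submodule.finrank_mono ?_
    rintro _ ⟨⟨w, hwX, hw⟩, hwf, rfl⟩
    refine ⟨hwX, fun i hi => ?_⟩
    rcases hi.eq_or_lt with h | h
    · obtain rfl : i = ⟨t, ht⟩ := Fin.ext h.symm
      exact hwf
    · exact hw i h
  omega

lemma finrank_inf_headWords_mono {n a b : ℕ} (X : Submodule (ZMod 2) (Fin n → Pauli))
    (h : a ≤ b) :
    Module.finrank (ZMod 2) ↥(X ⊓ headWords n a) ≤
      Module.finrank (ZMod 2) ↥(X ⊓ headWords n b) :=
  Submodule.finrank_mono (inf_le_inf_left _ (headWords_mono n h))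

lemma finrank_headWords {n t : ℕ} (ht : t ≤ n) :
    Module.finrank (ZMod 2) (headWords n t) = 2 * t := by
  have hstep : ∀ t < n, Module.finrank (ZMod 2) (headWords n (t + 1)) ≤
      Module.finrank (ZMod 2) (headWords n t) + 2 := fun t ht => by
    have h := finrank_inf_headWords_succ_le ⊤ ht
    rwa [top_inf_eq, top_inf_eq] at h
  have hle : ∀ t ≤ n, Module.finrank (ZMod 2) (headWords n t) ≤ 2 * t := by
    intro t
    induction t with
    | zero => simp [headWords_zero]
    | succ t ih => intro h; have := hstep t h; have := ih (by omega); omega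
  have hge : ∀ j ≤ n, 2 * (n - j) ≤ Module.finrank (ZMod 2) (headWords n (n - j)) := by
    intro j
    induction j with
    | zero => rw [Nat.sub_zero, headWords_self, finrank_top, finrank_words]; exact fun _ => le_rfl
    | succ j ih =>
      intro h
      have h1 := hstep (n - (j + 1)) (by omega)
      have h2 := ih (by omega)
      rw [show n - (j + 1) + 1 = n - j by omega] at h1
      omega
  have h1 := hle t ht
  have h2 := hge (n - t) (by omega)
  rw [show n - (n - t) = t by omega] at h2
  omega

/-! ### Symplectic duality -/

/-- The symplectic pairing as a bilinear form. -/
def symplForm (n : ℕ) : LinearMap.BilinForm (ZMod 2) (Fin n → Pauli) :=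
  LinearMap.mk₂ (ZMod 2) symplPair
    (fun a b c => by
      simp only [symplPair, ← Finset.sum_add_distrib]
      exact Finset.sum_congr rfl fun i _ => by simp; ring)
    (fun r a b => by
      simp only [symplPair, smul_eq_mul, Finset.mul_sum]
      exact Finset.sum_congr rfl fun i _ => by simp; ring)
    (fun a b c => by
      simp only [symplPair, ← Finset.sum_add_distrib]
      exact Finset.sum_congr rfl fun i _ => by simp; ring)
    (fun r a b => by
      simp only [symplPair, smul_eq_mul, Finset.mul_sum]
      exact Finset.sum_congr rfl fun i _ => by simp; ring)

lemma symplForm_apply {n : ℕ} (a b : Fin n → Pauli) : symplForm n a b = symplPair a b := rfl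

lemma symplPair_comm {n : ℕ} (a b : Fin n → Pauli) : symplPair a b = symplPair b a :=
  Finset.sum_congr rfl fun i _ => by ring

lemma symplPair_single {n : ℕ} (i : Fin n) (x : Pauli) (b : Fin n → Pauli) :
    symplPair (Pi.single i x) b = x.1 * (b i).2 + x.2 * (b i).1 := by
  rw [symplPair, Finset.sum_eq_single i]
  · simp
  · intro j _ hj
    simp [hj]
  · simp

lemma eq_zero_of_symplPair_single {n : ℕ} {i : Fin n} {b : Fin n → Pauli}
    (h : ∀ x : Pauli, symplPair (Pi.single i x) b = 0) : b i = 0 := by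
  have h1 := h (0, 1)
  have h2 := h (1, 0)
  simp only [symplPair_single, zero_mul, one_mul, zero_add, add_zero] at h1 h2
  exact Prod.ext h1 h2

lemma symplForm_isRefl (n : ℕ) : (symplForm n).IsRefl := fun a b h => by
  rw [symplForm_apply] at h ⊢
  rw [symplPair_comm, h]

lemma symplForm_nondegenerate (n : ℕ) : (symplForm n).Nondegenerate := by
  refine ((symplForm_isRefl n).nondegenerate_iff_separatingRight).2 fun b hb => ?_
  funext i
  exact eq_zero_of_symplPair_single fun x => hb _

lemma orthogonal_headWords (n t : ℕ) :
    (symplForm n).orthogonal (headWords n t) = tailWords n t := by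
  ext w
  rw [LinearMap.BilinForm.mem_orthogonal_iff, mem_tailWords]
  constructor
  · intro h i hi
    refine eq_zero_of_symplPair_single fun x => h (Pi.single i x) fun j hj => ?_
    have hne : j ≠ i := by rintro rfl; omega
    simp [hne]
  · intro h v hv
    rw [symplForm_apply, symplPair]
    refine Finset.sum_eq_zero fun i _ => ?_
    by_cases hi : (i : ℕ) < t
    · simp [h i hi]
    · simp [hv i (by omega)]

lemma finrank_orthogonal_inf_tailWords {n t : ℕ} (S : Submodule (ZMod 2) (Fin n → Pauli))
    (ht : t ≤ n) :
    Module.finrank (ZMod 2) ↥((symplForm n).orthogonal S ⊓ tailWords n t) +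
        (Module.finrank (ZMod 2) S + 2 * t) =
      2 * n + Module.finrank (ZMod 2) ↥(S ⊓ headWords n t) := by
  have h1 : (symplForm n).orthogonal S ⊓ tailWords n t =
      (symplForm n).orthogonal (S ⊔ headWords n t) := by
    rw [← orthogonal_headWords]
    ext w
    simp only [Submodule.mem_inf, LinearMap.BilinForm.mem_orthogonal_iff]
    constructor
    · rintro ⟨h, h'⟩ v hv
      obtain ⟨a, ha, b, hb, rfl⟩ := Submodule.mem_sup.1 hv
      simp only [map_add, LinearMap.add_apply] at *
      rw [h a ha, h' b hb, add_zero]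
    · exact fun h => ⟨fun v hv => h v (Submodule.mem_sup_left hv),
        fun v hv => h v (Submodule.mem_sup_right hv)⟩
  have h2 := LinearMap.BilinForm.finrank_orthogonal (symplForm_nondegenerate n)
    (S ⊔ headWords n t)
  have h3 := Submodule.finrank_sup_add_finrank_inf_eq S (headWords n t)
  have h4 := Submodule.finrank_le (S ⊔ headWords n t)
  rw [finrank_headWords ht] at h3
  rw [finrank_words] at h2 h4
  rw [h1]
  omega

/-- The words of `N` that are the sum of a word of `S` on the coordinates `< a` and a word of `N`
on the coordinates `≥ b`. -/
def splitWords {n : ℕ} (S N : Submodule (ZMod 2) (Fin n → Pauli)) (a b : ℕ) :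
    Submodule (ZMod 2) (Fin n → Pauli) :=
  S ⊓ headWords n a ⊔ N ⊓ tailWords n b

section Split

variable {n : ℕ} {S N : Submodule (ZMod 2) (Fin n → Pauli)}

lemma splitWords_le (h : S ≤ N) (a b : ℕ) : splitWords S N a b ≤ N :=
  sup_le (inf_le_left.trans h) inf_le_left

lemma splitWords_mono {a b a' b' : ℕ} (ha : a ≤ a') (hb : b' ≤ b) :
    splitWords S N a b ≤ splitWords S N a' b' :=
  sup_le_sup (inf_le_inf_left _ (headWords_mono n ha)) (inf_le_inf_left _ (tailWords_anti n hb))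

lemma splitWords_self : splitWords S N n n = S := by
  simp [splitWords, headWords_self, tailWords_self]

lemma splitWords_zero : splitWords S N 0 0 = N := by
  simp [splitWords, headWords_zero, tailWords_zero]

lemma apply_eq_zero_of_mem_splitWords {w : Fin n → Pauli} {t : ℕ}
    (hw : w ∈ splitWords S N t (t + 1)) (i : Fin n) (hi : (i : ℕ) = t) : w i = 0 := by
  obtain ⟨a, ha, b, hb, rfl⟩ := Submodule.mem_sup.1 hw
  simp [ha.2 i hi.ge, hb.2 i (by omega)]

lemma finrank_splitWords {a b : ℕ} (h : a ≤ b) :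
    Module.finrank (ZMod 2) (splitWords S N a b) =
      Module.finrank (ZMod 2) ↥(S ⊓ headWords n a) +
        Module.finrank (ZMod 2) ↥(N ⊓ tailWords n b) := by
  have h1 := Submodule.finrank_sup_add_finrank_inf_eq (S ⊓ headWords n a) (N ⊓ tailWords n b)
  have h2 : S ⊓ headWords n a ⊓ (N ⊓ tailWords n b) = ⊥ :=
    le_bot_iff.1 ((inf_le_inf inf_le_right inf_le_right).trans_eq
      (headWords_inf_tailWords n h))
  rw [h2, finrank_bot, add_zero] at h1
  exact h1

/-- The cosets of `splitWords S N a b` in `N`. -/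
abbrev SplitQuotient (S N : Submodule (ZMod 2) (Fin n → Pauli)) (a b : ℕ) : Type :=
  N ⧸ (splitWords S N a b).submoduleOf N

instance {a b : ℕ} : Finite (SplitQuotient S N a b) :=
  Quotient.finite _

lemma SplitQuotient.mk_eq {a b : ℕ} {v w : N} :
    (Submodule.Quotient.mk v : SplitQuotient S N a b) = Submodule.Quotient.mk w ↔
      (v : Fin n → Pauli) - w ∈ splitWords S N a b := by
  rw [Submodule.Quotient.eq]
  rfl

lemma natCard_splitQuotient (hSN : S ≤ N) (a b : ℕ) :
    Nat.card (SplitQuotient S N a b) =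
      2 ^ (Module.finrank (ZMod 2) N - Module.finrank (ZMod 2) (splitWords S N a b)) := by
  rw [Module.natCard_eq_pow_finrank (K := ZMod 2), Nat.card_zmod]
  have h1 : Module.finrank (ZMod 2) (SplitQuotient S N a b) + _ = _ :=
    Submodule.finrank_quotient_add_finrank ((splitWords S N a b).submoduleOf N)
  rw [(Submodule.submoduleOfEquivOfLe (splitWords_le hSN a b)).finrank_eq] at h1
  congr 1
  omega

end Split

/-! ### Splicing paths -/

namespace Trellis

namespace Path

variable {A : Type} {n : ℕ} {T : Trellis A n}

/-- Follow `p` up to time `t` and `q` afterwards. -/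
def splice (p q : T.Path) (t : ℕ) (ht : t ≤ n) (h : p.vert t ht = q.vert t ht) : T.Path where
  vert i hi := if i ≤ t then p.vert i hi else q.vert i hi
  label i := if (i : ℕ) < t then p.label i else q.label i
  mem i hi := by
    rcases lt_trichotomy i t with hit | rfl | hit
    · simp only [hit.le, hit, Nat.succ_le_of_lt hit, if_true]
      exact p.mem i hi
    · simp only [le_refl, lt_irrefl, Nat.not_succ_le_self, if_true, if_false, h]
      exact q.mem i hi
    · simp only [not_le.2 hit, not_lt.2 hit.le, not_le.2 (hit.trans (Nat.lt_succ_self i)),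
        if_false]
      exact q.mem i hi

lemma splice_label (p q : T.Path) (t : ℕ) (ht : t ≤ n) (h : p.vert t ht = q.vert t ht)
    (i : Fin n) :
    (p.splice q t ht h).label i = if (i : ℕ) < t then p.label i else q.label i := rfl

lemma splice_vert_last (p q : T.Path) (t : ℕ) (ht : t ≤ n) (h : p.vert t ht = q.vert t ht) :
    (p.splice q t ht h).vert n le_rfl = q.vert n le_rfl := by
  change (if n ≤ t then p.vert n _ else q.vert n _) = _
  split_ifs with hnt
  · obtain rfl : t = n := le_antisymm ht hnt
    exact h
  · rfl

/-- Follow `p` up to time `t`, then an edge labelled `a`, and `q` afterwards. -/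
def spliceEdge (p q : T.Path) (t : ℕ) (ht : t < n) (a : A)
    (h : (p.vert t ht.le, q.vert (t + 1) ht, a) ∈ T.E t) : T.Path where
  vert i hi := if i ≤ t then p.vert i hi else q.vert i hi
  label i := if (i : ℕ) < t then p.label i else if (i : ℕ) = t then a else q.label i
  mem i hi := by
    rcases lt_trichotomy i t with hit | rfl | hit
    · simp only [hit.le, hit, Nat.succ_le_of_lt hit, if_true]
      exact p.mem i hi
    · simp only [le_refl, lt_irrefl, Nat.not_succ_le_self, if_true, if_false]
      exact h
    · simp only [not_le.2 hit, not_lt.2 hit.le, hit.ne',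
        not_le.2 (hit.trans (Nat.lt_succ_self i)), if_false]
      exact q.mem i hi

lemma exists_of_edge {t : ℕ} (ht : t < n) {u : T.V t} {v : T.V (t + 1)} {a : A}
    (he : (u, v, a) ∈ T.E t) (hu : ∃ p : T.Path, p.vert t ht.le = u)
    (hv : ∃ p : T.Path, p.vert (t + 1) ht = v) :
    ∃ p : T.Path, p.vert t ht.le = u ∧ p.vert (t + 1) ht = v ∧ p.label ⟨t, ht⟩ = a := by
  obtain ⟨p, rfl⟩ := hu
  obtain ⟨q, rfl⟩ := hv
  exact ⟨p.spliceEdge q t ht a he, by simp [spliceEdge], by simp [spliceEdge],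
    by simp [spliceEdge]⟩

end Path

/-! ### Trellises separating the cosets of `S` in `N` -/

variable {n : ℕ}

/-- The words of the paths of `T` are exactly those of `N`, and paths with a common goal have
words in a common coset of `S`. -/
structure SeparatesCosets (T : Trellis Pauli n)
    (S N : Submodule (ZMod 2) (Fin n → Pauli)) : Prop where
  exists_path : ∀ w ∈ N, ∃ p : T.Path, p.label = w
  label_mem : ∀ p : T.Path, p.label ∈ N
  label_sub_mem : ∀ p q : T.Path, p.vert n le_rfl = q.vert n le_rfl → p.label - q.label ∈ S

namespace SeparatesCosets

variable {T : Trellis Pauli n} {S N : Submodule (ZMod 2) (Fin n → Pauli)}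

lemma sub_mem_splitWords (hT : T.SeparatesCosets S N) {p q : T.Path} {t : ℕ} (ht : t ≤ n)
    (h : p.vert t ht = q.vert t ht) : p.label - q.label ∈ splitWords S N t t := by
  set r := p.splice q t ht h
  rw [← sub_add_sub_cancel' r.label q.label p.label]
  refine add_mem (Submodule.mem_sup_left ⟨?_, ?_⟩) (Submodule.mem_sup_right ⟨?_, ?_⟩)
  · exact hT.label_sub_mem _ _ (p.splice_vert_last q t ht h)
  · intro i hi
    simp [r, Path.splice_label, not_lt.2 hi]
  · exact sub_mem (hT.label_mem _) (hT.label_mem _)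
  · intro i hi
    simp [r, Path.splice_label, hi]

/-- A path presenting a representative of the given class. -/
noncomputable def pathOf (hT : T.SeparatesCosets S N) {a b : ℕ} (c : SplitQuotient S N a b) :
    T.Path :=
  (hT.exists_path c.out c.out.2).choose

lemma mk_label_pathOf (hT : T.SeparatesCosets S N) {a b : ℕ} (c : SplitQuotient S N a b) :
    Submodule.Quotient.mk ⟨(hT.pathOf c).label, hT.label_mem _⟩ = c := by
  have h : (⟨(hT.pathOf c).label, hT.label_mem _⟩ : N) = c.out :=
    Subtype.ext (hT.exists_path c.out c.out.2).choose_spec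
  rw [h]
  exact Quotient.out_eq c

/-- The vertex at time `t` attached to a class of words. -/
noncomputable def vertOf (hT : T.SeparatesCosets S N) {t : ℕ} (ht : t ≤ n)
    (c : SplitQuotient S N t t) : T.V t :=
  (hT.pathOf c).vert t ht

lemma eq_mk_of_vertOf_eq (hT : T.SeparatesCosets S N) {t : ℕ} (ht : t ≤ n)
    {c : SplitQuotient S N t t} {p : T.Path} (h : hT.vertOf ht c = p.vert t ht) :
    c = Submodule.Quotient.mk ⟨p.label, hT.label_mem p⟩ := by
  rw [← hT.mk_label_pathOf c, SplitQuotient.mk_eq]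
  exact hT.sub_mem_splitWords ht h

lemma vertOf_injective (hT : T.SeparatesCosets S N) {t : ℕ} (ht : t ≤ n) :
    Function.Injective (hT.vertOf ht) := fun c c' h => by
  rw [hT.eq_mk_of_vertOf_eq ht h, hT.mk_label_pathOf]

lemma natCard_splitQuotient_le (hT : T.SeparatesCosets S N) {t : ℕ} (ht : t ≤ n) :
    Nat.card (SplitQuotient S N t t) ≤ Fintype.card (T.V t) := by
  rw [← Nat.card_eq_fintype_card]
  exact Nat.card_le_card_of_injective _ (hT.vertOf_injective ht)

lemma vertOf_surjective (hT : T.SeparatesCosets S N)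
    (hcard : ∀ t ≤ n, Fintype.card (T.V t) = Nat.card (SplitQuotient S N t t))
    {t : ℕ} (ht : t ≤ n) : Function.Surjective (hT.vertOf ht) := by
  refine ((Nat.bijective_iff_injective_and_card _).2 ⟨hT.vertOf_injective ht, ?_⟩).2
  rw [← hcard t ht, Nat.card_eq_fintype_card]

lemma vert_eq_of_sub_mem (hT : T.SeparatesCosets S N)
    (hcard : ∀ t ≤ n, Fintype.card (T.V t) = Nat.card (SplitQuotient S N t t))
    {t : ℕ} (ht : t ≤ n) {p q : T.Path}
    (h : p.label - q.label ∈ splitWords S N t t) : p.vert t ht = q.vert t ht := by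
  obtain ⟨c, hc⟩ := hT.vertOf_surjective hcard ht (p.vert t ht)
  obtain ⟨d, hd⟩ := hT.vertOf_surjective hcard ht (q.vert t ht)
  rw [← hc, ← hd, hT.eq_mk_of_vertOf_eq ht hc, hT.eq_mk_of_vertOf_eq ht hd,
    (SplitQuotient.mk_eq (v := ⟨p.label, hT.label_mem p⟩) (w := ⟨q.label, hT.label_mem q⟩)).2 h]

lemma card_edges_le (hT : T.SeparatesCosets S N)
    (hcard : ∀ t ≤ n, Fintype.card (T.V t) = Nat.card (SplitQuotient S N t t))
    {t : ℕ} (ht : t < n) :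
    (T.E t).card ≤ Nat.card (SplitQuotient S N t (t + 1)) := by
  have hex : ∀ e : T.E t, ∃ p : T.Path,
      p.vert t ht.le = e.1.1 ∧ p.vert (t + 1) ht = e.1.2.1 ∧ p.label ⟨t, ht⟩ = e.1.2.2 :=
    fun e => Path.exists_of_edge ht e.2
      ((hT.vertOf_surjective hcard ht.le e.1.1).imp' _ fun _ h => h)
      ((hT.vertOf_surjective hcard ht e.1.2.1).imp' _ fun _ h => h)
  choose f hf using hex
  rw [← Fintype.card_coe, ← Nat.card_eq_fintype_card]
  refine Nat.card_le_card_of_injective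
    (fun e => (Submodule.Quotient.mk ⟨(f e).label, hT.label_mem _⟩ :
      SplitQuotient S N t (t + 1))) fun e e' h => ?_
  have hmem := SplitQuotient.mk_eq.1 h
  obtain ⟨h1, h2, h3⟩ := hf e
  obtain ⟨h1', h2', h3'⟩ := hf e'
  refine Subtype.ext (Prod.ext ?_ (Prod.ext ?_ ?_))
  · rw [← h1, ← h1']
    exact hT.vert_eq_of_sub_mem hcard ht.le (splitWords_mono le_rfl t.le_succ hmem)
  · rw [← h2, ← h2']
    exact hT.vert_eq_of_sub_mem hcard ht (splitWords_mono t.le_succ le_rfl hmem)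
  · rw [← h3, ← h3']
    exact sub_eq_zero.1 (apply_eq_zero_of_mem_splitWords hmem ⟨t, ht⟩ rfl)

end SeparatesCosets

/-! ### The canonical trellis -/

section Canonical

variable (S N : Submodule (ZMod 2) (Fin n → Pauli))

open Classical in
/-- The trellis whose vertices at time `t` are the cosets of `splitWords S N t t` in `N`. -/
noncomputable def canonical : Trellis Pauli n where
  V t := SplitQuotient S N t t
  instFin _ := Fintype.ofFinite _
  instDec _ := inferInstance
  root := Submodule.Quotient.mk 0
  root_unique v := by
    obtain ⟨w, rfl⟩ := Submodule.Quotient.mk_surjective _ v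
    rw [SplitQuotient.mk_eq, splitWords_zero]
    exact sub_mem w.2 (zero_mem _)
  E t := if ht : t < n then
      (Set.toFinite (Set.range fun w : N =>
        ((Submodule.Quotient.mk w : SplitQuotient S N t t),
          (Submodule.Quotient.mk w : SplitQuotient S N (t + 1) (t + 1)),
          (w : Fin n → Pauli) ⟨t, ht⟩))).toFinset
    else ∅

variable {S N}

lemma mem_canonical_E {t : ℕ} (ht : t < n) {u : SplitQuotient S N t t}
    {v : SplitQuotient S N (t + 1) (t + 1)} {a : Pauli} :
    (u, v, a) ∈ (canonical S N).E t ↔ ∃ w : N, Submodule.Quotient.mk w = u ∧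
      Submodule.Quotient.mk w = v ∧ (w : Fin n → Pauli) ⟨t, ht⟩ = a := by
  rw [show (canonical S N).E t = _ from dif_pos ht]
  refine (Set.Finite.mem_toFinset _).trans (exists_congr fun w => ?_)
  rw [Prod.mk.injEq, Prod.mk.injEq]

lemma card_canonical_V (t : ℕ) :
    Fintype.card ((canonical S N).V t) = Nat.card (SplitQuotient S N t t) :=
  Nat.card_eq_fintype_card.symm

/-- The path of the canonical trellis given by a word of `N`. -/
noncomputable def canonicalPath (w : N) : (canonical S N).Path where
  vert _ _ := Submodule.Quotient.mk w
  label := w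
  mem _ ht := (mem_canonical_E ht).2 ⟨w, rfl, rfl, rfl⟩

lemma exists_prefix_of_canonical_path (hSN : S ≤ N) (p : (canonical S N).Path) :
    ∀ (t : ℕ) (ht : t ≤ n), ∃ w : N,
      (Submodule.Quotient.mk w : SplitQuotient S N t t) = p.vert t ht ∧
      ∀ i : Fin n, (i : ℕ) < t → (w : Fin n → Pauli) i = p.label i := by
  intro t
  induction t with
  | zero =>
    intro ht
    exact ⟨0, ((canonical S N).root_unique _).symm, fun i hi => absurd hi (Nat.not_lt_zero _)⟩
  | succ t ih =>
    intro ht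
    obtain ⟨w, hw, hwl⟩ := ih (by omega)
    obtain ⟨w', hw', hv, ha⟩ := (mem_canonical_E ht).1 (p.mem t ht)
    have hmem := SplitQuotient.mk_eq.1 (hw.trans hw'.symm)
    obtain ⟨s, hs, f, hf, hsf⟩ := Submodule.mem_sup.1 hmem
    refine ⟨w' + ⟨s, hSN hs.1⟩, ?_, fun i hi => ?_⟩
    · rw [← hv, SplitQuotient.mk_eq]
      refine Submodule.mem_sup_left ⟨by simpa using hs.1, ?_⟩
      simpa using headWords_mono n t.le_succ hs.2
    · rcases Nat.lt_succ_iff_lt_or_eq.1 hi with hit | hit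
      · have h1 : s i + f i = (w : Fin n → Pauli) i - (w' : Fin n → Pauli) i :=
          congrFun hsf i
        rw [hf.2 i hit, add_zero, hwl i hit] at h1
        simp [h1]
      · obtain rfl : i = ⟨t, ht⟩ := Fin.ext hit
        simpa [hs.2 ⟨t, ht⟩ le_rfl] using ha

lemma canonical_wordsTo (hSN : S ≤ N) (w : N) :
    (canonical S N).WordsTo (Submodule.Quotient.mk w : SplitQuotient S N n n) =
      {x : Fin n → Pauli | x - (w : Fin n → Pauli) ∈ S} := by
  ext x
  constructor
  · rintro ⟨p, hp, rfl⟩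
    obtain ⟨w', hw', hl⟩ := exists_prefix_of_canonical_path hSN p n le_rfl
    have h := SplitQuotient.mk_eq.1 (hw'.trans hp)
    rw [splitWords_self] at h
    rwa [show p.label = w' from (funext fun i => hl i i.2).symm]
  · intro hx
    have hxN : x ∈ N := by simpa using add_mem (hSN hx) w.2
    refine ⟨canonicalPath ⟨x, hxN⟩, ?_, rfl⟩
    refine SplitQuotient.mk_eq.2 ?_
    rw [splitWords_self]
    exact hx

end Canonical

section Represents

variable {S N : Submodule (ZMod 2) (Fin n → Pauli)} {ι : Type}
  {Cs : ι → Set (Fin n → Pauli)}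

lemma Represents.separatesCosets {T : Trellis Pauli n} (hT : T.Represents Cs)
    (hCs : ∀ i, ∃ ℓ ∈ N, Cs i = {w | w - ℓ ∈ S}) (hcover : ⋃ i, Cs i = (N : Set _)) :
    T.SeparatesCosets S N := by
  obtain ⟨φ, hφ⟩ := hT
  have hlabel : ∀ (p : T.Path) (i : ι), p.vert n le_rfl = φ i → p.label ∈ Cs i :=
    fun p i h => hφ i ▸ ⟨p, h, rfl⟩
  refine ⟨fun w hw => ?_, fun p => ?_, fun p q h => ?_⟩
  · rw [← SetLike.mem_coe, ← hcover] at hw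
    obtain ⟨i, hi⟩ := Set.mem_iUnion.1 hw
    rw [← hφ i] at hi
    obtain ⟨p, -, hp⟩ := hi
    exact ⟨p, hp⟩
  · obtain ⟨i, hi⟩ := φ.surjective (p.vert n le_rfl)
    rw [← SetLike.mem_coe, ← hcover]
    exact Set.mem_iUnion.2 ⟨i, hlabel p i hi.symm⟩
  · obtain ⟨i, hi⟩ := φ.surjective (q.vert n le_rfl)
    obtain ⟨ℓ, -, hℓ⟩ := hCs i
    have h1 := hlabel p i (h.trans hi.symm)
    have h2 := hlabel q i hi.symm
    rw [hℓ, Set.mem_ofPred_eq] at h1 h2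
    simpa using sub_mem h1 h2

lemma canonical_represents (hSN : S ≤ N) (hCs : ∀ i, ∃ ℓ ∈ N, Cs i = {w | w - ℓ ∈ S})
    (hinj : Function.Injective Cs) (hcover : ⋃ i, Cs i = (N : Set _)) :
    (canonical S N).Represents Cs := by
  choose ℓ hℓ hC using hCs
  let g : ι → SplitQuotient S N n n := fun i => Submodule.Quotient.mk ⟨ℓ i, hℓ i⟩
  have hg : ∀ i, (canonical S N).WordsTo (g i) = Cs i := fun i => by
    rw [hC i]
    exact canonical_wordsTo hSN ⟨ℓ i, hℓ i⟩
  have hbij : Function.Bijective g := by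
    refine ⟨fun i j h => hinj ?_, fun c => ?_⟩
    · rw [← hg i, ← hg j, h]
    · obtain ⟨w, rfl⟩ := Submodule.Quotient.mk_surjective _ c
      have hw := w.2
      rw [← SetLike.mem_coe, ← hcover] at hw
      obtain ⟨i, hi⟩ := Set.mem_iUnion.1 hw
      rw [hC i] at hi
      refine ⟨i, (SplitQuotient.mk_eq.2 ?_).symm⟩
      rw [splitWords_self]
      exact hi
  exact ⟨Equiv.ofBijective g hbij, hg⟩

lemma MinimalRep.card_V_eq {T : Trellis Pauli n} (hT : T.MinimalRep Cs) (hSN : S ≤ N)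
    (hCs : ∀ i, ∃ ℓ ∈ N, Cs i = {w | w - ℓ ∈ S}) (hinj : Function.Injective Cs)
    (hcover : ⋃ i, Cs i = (N : Set _)) :
    ∀ t ≤ n, Fintype.card (T.V t) = Nat.card (SplitQuotient S N t t) := by
  have hsep := hT.1.separatesCosets hCs hcover
  have hle : ∀ t ∈ Finset.range (n + 1),
      Nat.card (SplitQuotient S N t t) ≤ Fintype.card (T.V t) := fun t ht =>
    hsep.natCard_splitQuotient_le (Nat.lt_succ_iff.1 (Finset.mem_range.1 ht))
  have hge := hT.2 _ (canonical_represents hSN hCs hinj hcover)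
  simp only [vertCard, card_canonical_V] at hge
  have heq := (Finset.sum_eq_sum_iff_of_le hle).1 (le_antisymm (Finset.sum_le_sum hle) hge)
  exact fun t ht => (heq t (Finset.mem_range.2 (Nat.lt_succ_of_le ht))).symm

end Represents

end Trellis

lemma finrank_zmod_two_eq_of_natCard_eq {n m : ℕ} {X : Submodule (ZMod 2) (Fin n → Pauli)}
    (h : Nat.card X = 2 ^ m) : Module.finrank (ZMod 2) X = m := by
  rw [Module.natCard_eq_pow_finrank (K := ZMod 2), Nat.card_zmod] at h
  exact Nat.pow_right_injective le_rfl h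

/-- The profile `u` is half the logarithm of the number of vertices. -/
lemma exists_unit_step_profile {n k : ℕ} (hk : k ≤ n)
    {S : Submodule (ZMod 2) (Fin n → Pauli)} (hSN : S ≤ (symplForm n).orthogonal S)
    (hS : Module.finrank (ZMod 2) S = n - k)
    (hN : Module.finrank (ZMod 2) ((symplForm n).orthogonal S) = n + k) :
    ∃ u : ℕ → ℕ, u 0 = 0 ∧ u n = k ∧ (∀ t < n, u (t + 1) ≤ u t + 1) ∧
      (∀ t < n, u t ≤ u (t + 1) + 1) ∧
      (∀ t ≤ n, Nat.card (SplitQuotient S ((symplForm n).orthogonal S) t t) = 2 ^ (2 * u t)) ∧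
      ∀ t < n, Nat.card (SplitQuotient S ((symplForm n).orthogonal S) t (t + 1)) =
        2 ^ (1 + u t + u (t + 1)) := by
  set N := (symplForm n).orthogonal S with hNdef
  set s : ℕ → ℕ := fun t => Module.finrank (ZMod 2) ↥(S ⊓ headWords n t) with hs
  have hs0 : s 0 = 0 := by simp [hs, headWords_zero]
  have hsn : s n = n - k := by rw [← hS]; simp only [hs]; rw [headWords_self, inf_top_eq]
  have hmono : ∀ t, s t ≤ s (t + 1) := fun t => finrank_inf_headWords_mono S t.le_succ
  have hsucc : ∀ t < n, s (t + 1) ≤ s t + 2 := fun t ht => finrank_inf_headWords_succ_le S ht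
  have hdual : ∀ t ≤ n, Module.finrank (ZMod 2) ↥(N ⊓ tailWords n t) + (n - k + 2 * t) =
      2 * n + s t := fun t ht => by
    have h := finrank_orthogonal_inf_tailWords S ht
    rwa [hS] at h
  have hsplit : ∀ a b, a ≤ b → Module.finrank (ZMod 2) (splitWords S N a b) =
      s a + Module.finrank (ZMod 2) ↥(N ⊓ tailWords n b) := fun a b h => finrank_splitWords h
  have hle : ∀ t ≤ n, s t ≤ t := fun t ht => by
    have h1 := Submodule.finrank_mono (splitWords_le hSN t t)
    have h2 := hsplit t t le_rfl
    have h3 := hdual t ht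
    rw [hN] at h1
    omega
  refine ⟨fun t => t - s t, by simp, ?_, ?_, ?_, ?_, ?_⟩
  · simp only [hsn]; omega
  · intro t ht
    have := hmono t
    have := hle t ht.le
    simp only
    omega
  · intro t ht
    have := hsucc t ht
    have := hle (t + 1) ht
    simp only
    omega
  · intro t ht
    rw [natCard_splitQuotient hSN, hN, hsplit t t le_rfl]
    have := hdual t ht
    have := hle t ht
    congr 1
    simp only
    omega
  · intro t ht
    rw [natCard_splitQuotient hSN, hN, hsplit t (t + 1) t.le_succ]
    have := hdual (t + 1) ht
    have := hle t ht.le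
    have := hle (t + 1) ht
    congr 1
    simp only
    omega

/-- **Upper bound on the trellis complexity of degenerate decoding.**  Let `S`
be an isotropic subgroup of `(𝔽₂²)^n` with `|S| = 2^{n−k}`, let `N` be its
symplectic complement (so `|N| = 2^{n+k}` and `S` has `2^{2k}` cosets in `N`),
and let `T` be the minimal multi-goal trellis representing the joint code whose
underlying code is `N` and whose subcodes are the cosets of `S` in `N`.  Then
`|V| ≤ (5·2^{n+k} − 2^{2k} − 1)/3 < (5/3)·2^{n+k}`,
`|E| ≤ (4/3)·(2^{n+k+1} − 2^{2k} − 1) < (8/3)·2^{n+k}` and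
`2|E| − |V| ≤ (11·2^{n+k} − 7·2^{2k} − 7)/3 < (11/3)·2^{n+k}`. -/
theorem minimal_multigoal_trellis_complexity_bounds
    {n k : ℕ} (hk : k ≤ n)
    (S N : AddSubgroup (Fin n → Pauli))
    (hScard : Nat.card S = 2 ^ (n - k))
    (hiso : ∀ s ∈ S, ∀ s' ∈ S, symplPair s s' = 0)
    (hN : (N : Set (Fin n → Pauli)) = {w | ∀ s ∈ S, symplPair w s = 0})
    (hNcard : Nat.card N = 2 ^ (n + k))
    {ι : Type} [Fintype ι] (hι : Fintype.card ι = 2 ^ (2 * k))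
    (Cs : ι → Set (Fin n → Pauli))
    (hCs : ∀ i, ∃ ℓ ∈ N, Cs i = {w | ∃ s ∈ S, w = ℓ + s})
    (hinj : Function.Injective Cs)
    (hcover : ⋃ i, Cs i = (N : Set (Fin n → Pauli)))
    (T : Trellis Pauli n) (hT : T.MinimalRep Cs) :
    (3 * (T.vertCard : ℤ) ≤ 5 * 2 ^ (n + k) - 2 ^ (2 * k) - 1 ∧
      3 * (T.vertCard : ℤ) < 5 * 2 ^ (n + k)) ∧
    (3 * (T.edgeCard : ℤ) ≤ 4 * (2 ^ (n + k + 1) - 2 ^ (2 * k) - 1) ∧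
      3 * (T.edgeCard : ℤ) < 8 * 2 ^ (n + k)) ∧
    (3 * (2 * (T.edgeCard : ℤ) - (T.vertCard : ℤ)) ≤
        11 * 2 ^ (n + k) - 7 * 2 ^ (2 * k) - 7 ∧
      3 * (2 * (T.edgeCard : ℤ) - (T.vertCard : ℤ)) < 11 * 2 ^ (n + k)) := by
  let S' : Submodule (ZMod 2) (Fin n → Pauli) := AddSubgroup.toZModSubmodule 2 S
  set N' := (symplForm n).orthogonal S' with hN'
  have hmemN : ∀ w, w ∈ N' ↔ w ∈ N := fun w => by
    rw [hN', LinearMap.BilinForm.mem_orthogonal_iff, ← SetLike.mem_coe (p := N), hN]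
    exact forall₂_congr fun s _ => by rw [symplForm_apply, symplPair_comm]
  have hNcoe : (N' : Set (Fin n → Pauli)) = N := Set.ext hmemN
  have hSN : S' ≤ N' := fun s hs s' hs' => hiso s' hs' s hs
  have hCs' : ∀ i, ∃ ℓ ∈ N', Cs i = {w | w - ℓ ∈ S'} := fun i => by
    obtain ⟨ℓ, hℓ, h⟩ := hCs i
    refine ⟨ℓ, (hmemN ℓ).2 hℓ, h.trans (Set.ext fun w => ?_)⟩
    constructor
    · rintro ⟨s, hs, rfl⟩
      have : ℓ + s - ℓ ∈ S' := by rwa [add_sub_cancel_left]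
      exact this
    · exact fun hw => ⟨w - ℓ, hw, (add_sub_cancel ℓ w).symm⟩
  rw [← hNcoe] at hcover
  have hSrank : Module.finrank (ZMod 2) S' = n - k := finrank_zmod_two_eq_of_natCard_eq hScard
  have hNrank : Module.finrank (ZMod 2) N' = n + k :=
    finrank_zmod_two_eq_of_natCard_eq ((congrArg (fun X : Set _ => Nat.card X) hNcoe).trans hNcard)
  obtain ⟨u, h0, hn, hup, hdown, hV, hE⟩ := exists_unit_step_profile hk hSN hSrank hNrank
  have hsep := hT.1.separatesCosets hCs' hcover
  have hcard := hT.card_V_eq hSN hCs' hinj hcover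
  have hVsum : (T.vertCard : ℤ) = ∑ t ∈ Finset.range (n + 1), 2 ^ (2 * u t) := by
    rw [Trellis.vertCard, Nat.cast_sum]
    refine Finset.sum_congr rfl fun t ht => ?_
    have ht' := Nat.lt_succ_iff.1 (Finset.mem_range.1 ht)
    rw [hcard t ht', hV t ht']
    norm_cast
  have hEsum : (T.edgeCard : ℤ) ≤ ∑ t ∈ Finset.range n, 2 ^ (1 + u t + u (t + 1)) := by
    rw [Trellis.edgeCard, Nat.cast_sum]
    refine Finset.sum_le_sum fun t ht => ?_
    have ht' := Finset.mem_range.1 ht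
    have h := hsep.card_edges_le hcard ht'
    rw [hE t ht'] at h
    exact_mod_cast h
  obtain ⟨b1, b2, b3⟩ := complexity_bounds_of_unit_steps hk u h0 hn hup hdown hVsum hEsum
  have hpos : (0 : ℤ) < 2 ^ (2 * k) := by positivity
  refine ⟨⟨b1, by linarith⟩, ⟨b2, ?_⟩, ⟨b3, by linarith⟩⟩
  rw [pow_succ] at b2
  linarith
end

section
/- Let n + k be even with 0 ≤ k ≤ n, and let D' ⊆ D ⊆ 𝔽_2^n be binary linear codes with dim D = (n+k)/2 and dim D' = (n−k)/2, so that D' has exactly 2^k cosets in D (this is the situation of the X- or Z-part of an [[n,k]] CSS code with equally many X- and Z-stabilizers). Let T = (V, E) be the minimal multi-goal trellis over the alphabet 𝔽_2 representing the joint code whose underlying code is D and whose subcode list consists of the 2^k cosets of D' in D. Then |V| ≤ 3·2^{(n+k)/2} − 2^k − 1 < 3·2^{(n+k)/2}, |E| ≤ 2·(2^{(n+k)/2+1} − 2^k − 1), and 2|E| − |V| ≤ 5·2^{(n+k)/2} − 3·2^k − 3 < 5·2^{(n+k)/2}. -/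
section CoordinateSubgroups

variable {A : Type} [AddCommGroup A] {n : ℕ}

/-- The words vanishing at all positions before `s`. -/
def futureWords (A : Type) [AddCommGroup A] (n s : ℕ) : AddSubgroup (Fin n → A) where
  carrier := {w | ∀ i : Fin n, (i : ℕ) < s → w i = 0}
  add_mem' := fun ha hb i hi => by simp [ha i hi, hb i hi]
  zero_mem' := fun _ _ => rfl
  neg_mem' := fun ha i hi => by simp [ha i hi]

/-- The words vanishing at all positions from `t` on. -/
def pastWords (A : Type) [AddCommGroup A] (n t : ℕ) : AddSubgroup (Fin n → A) where
  carrier := {w | ∀ i : Fin n, t ≤ (i : ℕ) → w i = 0}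
  add_mem' := fun ha hb i hi => by simp [ha i hi, hb i hi]
  zero_mem' := fun _ _ => rfl
  neg_mem' := fun ha i hi => by simp [ha i hi]

lemma mem_futureWords {s : ℕ} {w : Fin n → A} :
    w ∈ futureWords A n s ↔ ∀ i : Fin n, (i : ℕ) < s → w i = 0 := Iff.rfl

lemma mem_pastWords {t : ℕ} {w : Fin n → A} :
    w ∈ pastWords A n t ↔ ∀ i : Fin n, t ≤ (i : ℕ) → w i = 0 := Iff.rfl

lemma futureWords_antitone : Antitone (futureWords A n) :=
  fun _ _ hst _ hw i hi => hw i (hi.trans_le hst)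

lemma pastWords_monotone : Monotone (pastWords A n) :=
  fun _ _ hst _ hw i hi => hw i (hst.trans hi)

lemma futureWords_zero : futureWords A n 0 = ⊤ :=
  top_unique fun _ _ _ hi => absurd hi (Nat.not_lt_zero _)

lemma futureWords_self : futureWords A n n = ⊥ :=
  bot_unique fun _ hw => AddSubgroup.mem_bot.2 (funext fun i => hw i i.2)

lemma pastWords_self : pastWords A n n = ⊤ :=
  top_unique fun _ _ i hi => absurd i.2 (not_lt.2 hi)

lemma pastWords_inf_futureWords {s t : ℕ} (h : t ≤ s) :
    pastWords A n t ⊓ futureWords A n s = ⊥ := by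
  refine bot_unique fun w hw => AddSubgroup.mem_bot.2 (funext fun i => ?_)
  rcases le_or_gt t i with hi | hi
  · exact hw.1 i hi
  · exact hw.2 i (hi.trans_le h)

lemma index_futureWords_le [Finite A] {s : ℕ} (hs : s ≤ n) :
    (futureWords A n s).index ≤ Nat.card A ^ s := by
  let f : (Fin n → A) →+ (Fin s → A) :=
    { toFun := fun w i => w (Fin.castLE hs i)
      map_zero' := rfl
      map_add' := fun _ _ => rfl }
  have hf : f.ker = futureWords A n s := by
    ext w
    rw [AddMonoidHom.mem_ker, mem_futureWords, funext_iff]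
    exact ⟨fun h i hi => h ⟨i, hi⟩, fun h i => h _ i.2⟩
  rw [← hf, AddSubgroup.index_ker]
  calc Nat.card f.range ≤ Nat.card (Fin s → A) :=
        Nat.card_le_card_of_injective _ Subtype.val_injective
    _ = _ := by simp [Nat.card_fun]

lemma index_pastWords_le [Finite A] {t : ℕ} (ht : t ≤ n) :
    (pastWords A n t).index ≤ Nat.card A ^ (n - t) := by
  let f : (Fin n → A) →+ (Fin (n - t) → A) :=
    { toFun := fun w i => w ⟨t + i, by omega⟩
      map_zero' := rfl
      map_add' := fun _ _ => rfl }
  have hf : f.ker = pastWords A n t := by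
    ext w
    rw [AddMonoidHom.mem_ker, mem_pastWords, funext_iff]
    refine ⟨fun h i hi => ?_, fun h i => h _ (Nat.le_add_right _ _)⟩
    have := h ⟨i - t, by omega⟩
    simpa [f, Nat.add_sub_cancel' hi] using this
  rw [← hf, AddSubgroup.index_ker]
  calc Nat.card f.range ≤ Nat.card (Fin (n - t) → A) :=
        Nat.card_le_card_of_injective _ Subtype.val_injective
    _ = _ := by simp [Nat.card_fun]

lemma relIndex_le_index_of_finite [Finite A] (H K : AddSubgroup (Fin n → A)) :
    H.relIndex K ≤ H.index :=
  Nat.le_of_dvd (Nat.pos_of_ne_zero AddSubgroup.FiniteIndex.index_ne_zero)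
    (AddSubgroup.relIndex_dvd_index_of_normal H K)

/-- The differences of words of `D` that cannot be told apart by a trellis of the cosets of `D'`
in `D` between the levels `t` and `s`: sums of a word of `D'` supported before `t` and a word of
`D` supported from `s` on. -/
def stateGroup (D D' : AddSubgroup (Fin n → A)) (t s : ℕ) : AddSubgroup (Fin n → A) :=
  (D' ⊓ pastWords A n t) ⊔ (D ⊓ futureWords A n s)

variable {D D' : AddSubgroup (Fin n → A)}

lemma mem_stateGroup {t s : ℕ} {w : Fin n → A} :
    w ∈ stateGroup D D' t s ↔ ∃ x, (x ∈ D' ∧ ∀ i : Fin n, t ≤ (i : ℕ) → x i = 0) ∧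
      ∃ y, (y ∈ D ∧ ∀ i : Fin n, (i : ℕ) < s → y i = 0) ∧ x + y = w :=
  AddSubgroup.mem_sup

lemma stateGroup_mono {t t' s s' : ℕ} (ht : t ≤ t') (hs : s' ≤ s) :
    stateGroup D D' t s ≤ stateGroup D D' t' s' :=
  sup_le_sup (inf_le_inf_left _ (pastWords_monotone ht))
    (inf_le_inf_left _ (futureWords_antitone hs))

lemma stateGroup_le (hDD : D' ≤ D) (t s : ℕ) : stateGroup D D' t s ≤ D :=
  sup_le (inf_le_left.trans hDD) inf_le_left

lemma le_stateGroup_zero (t : ℕ) : D ≤ stateGroup D D' t 0 := by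
  rw [stateGroup, futureWords_zero, inf_top_eq]
  exact le_sup_right

lemma stateGroup_last : stateGroup D D' n n = D' := by
  rw [stateGroup, futureWords_self, pastWords_self, inf_top_eq, inf_bot_eq, sup_bot_eq]

lemma card_mul_relIndex_stateGroup (hDD : D' ≤ D) {t s : ℕ} (hts : t ≤ s) :
    Nat.card D' * (stateGroup D D' t s).relIndex D =
      (futureWords A n s).relIndex D * (pastWords A n t).relIndex D' := by
  set X := D' ⊓ pastWords A n t with hX
  set Y := D ⊓ futureWords A n s with hY
  have hbot : X ⊓ Y = ⊥ := by
    refine bot_unique ?_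
    rw [← pastWords_inf_futureWords (A := A) (n := n) hts]
    exact inf_le_inf inf_le_right inf_le_right
  have hYX : Y.relIndex (X ⊔ Y) = Nat.card X := by
    rw [AddSubgroup.relIndex_sup_right, ← AddSubgroup.inf_relIndex_left, hbot,
      AddSubgroup.relIndex_bot_left]
  have hp : Nat.card X * (X ⊔ Y).relIndex D = (futureWords A n s).relIndex D := by
    rw [← hYX, AddSubgroup.relIndex_mul_relIndex _ _ _ le_sup_right (stateGroup_le hDD t s),
      AddSubgroup.inf_relIndex_left]
  have hq : Nat.card X * (pastWords A n t).relIndex D' = Nat.card D' := by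
    rw [← AddSubgroup.inf_relIndex_left (K := pastWords A n t), ← hX,
      ← AddSubgroup.relIndex_bot_left, ← AddSubgroup.relIndex_bot_left]
    exact AddSubgroup.relIndex_mul_relIndex _ _ _ bot_le inf_le_left
  rw [← hp, ← hq, stateGroup]
  ring

end CoordinateSubgroups

/-- `Cs` enumerates the cosets of `D'` in `D`. -/
structure IsCosetFamily {A : Type} [AddCommGroup A] {n : ℕ} (D D' : AddSubgroup (Fin n → A))
    {ι : Type} (Cs : ι → Set (Fin n → A)) : Prop where
  le : D' ≤ D
  injective : Function.Injective Cs
  nonempty : ∀ i, (Cs i).Nonempty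
  subset : ∀ i, ∀ w ∈ Cs i, w ∈ D
  mem_iff : ∀ i, ∀ w ∈ Cs i, ∀ w', w' ∈ Cs i ↔ w' - w ∈ D'
  cover : ∀ w ∈ D, ∃ i, w ∈ Cs i

namespace Trellis

variable {A : Type} {n : ℕ}

/-- The path following `p` up to level `t`, then an edge with label `a`, and then `q`. -/
def Path.join {T : Trellis A n} (p q : T.Path) (t : ℕ) (ht : t < n) (a : A)
    (h : (p.vert t ht.le, q.vert (t + 1) ht, a) ∈ T.E t) : T.Path where
  vert i hi := if i ≤ t then p.vert i hi else q.vert i hi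
  label i := if (i : ℕ) < t then p.label i else if (i : ℕ) = t then a else q.label i
  mem i hi := by
    rcases lt_trichotomy i t with hit | rfl | hit
    · have h1 : i ≤ t := hit.le
      have h2 : i + 1 ≤ t := hit
      simpa [h1, h2, hit] using p.mem i hi
    · simpa using h
    · have h1 : ¬ i ≤ t := by omega
      have h2 : ¬ i + 1 ≤ t := by omega
      have h3 : ¬ i < t := by omega
      have h4 : ¬ i = t := by omega
      simpa [h1, h2, h3, h4] using q.mem i hi

variable [AddCommGroup A]

section Quotient

variable [Finite A]

/-- The trellis whose vertices at level `t` are the classes of words of `D` modulo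
`stateGroup D D' t t`, each word of `D` being the word of the path through its classes. -/
noncomputable def quotient (D D' : AddSubgroup (Fin n → A)) : Trellis A n where
  V t := D ⧸ (stateGroup D D' t t).addSubgroupOf D
  instFin _ := Fintype.ofFinite _
  instDec _ := Classical.decEq _
  root := 0
  root_unique v := by
    induction v using QuotientAddGroup.induction_on with
    | H w =>
      rw [QuotientAddGroup.eq_zero_iff, AddSubgroup.mem_addSubgroupOf]
      exact le_stateGroup_zero 0 w.2
  E t := (Set.toFinite {e | ∃ (w : D) (h : t < n), e =
    ((w : D ⧸ (stateGroup D D' t t).addSubgroupOf D),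
      (w : D ⧸ (stateGroup D D' (t + 1) (t + 1)).addSubgroupOf D), w.1 ⟨t, h⟩)}).toFinset

variable {D D' : AddSubgroup (Fin n → A)}

/-- The class of a word of `D` at level `t` of the quotient trellis. -/
def quotientState (D' : AddSubgroup (Fin n → A)) (t : ℕ) (w : D) : (quotient D D').V t :=
  (w : D ⧸ (stateGroup D D' t t).addSubgroupOf D)

lemma quotientState_surjective (t : ℕ) :
    Function.Surjective (quotientState (D := D) D' t) :=
  QuotientAddGroup.mk_surjective

lemma quotientState_eq_iff {t : ℕ} {w w' : D} :
    quotientState D' t w = quotientState D' t w' ↔ w.1 - w'.1 ∈ stateGroup D D' t t := by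
  exact QuotientAddGroup.eq_iff_sub_mem.trans AddSubgroup.mem_addSubgroupOf

lemma mem_quotient_E {t : ℕ} (h : t < n) {u : (quotient D D').V t}
    {v : (quotient D D').V (t + 1)} {a : A} : (u, v, a) ∈ (quotient D D').E t ↔
      ∃ w : D, u = quotientState D' t w ∧ v = quotientState D' (t + 1) w ∧ a = w.1 ⟨t, h⟩ := by
  refine (Set.Finite.mem_toFinset _).trans ⟨?_, ?_⟩
  · rintro ⟨w, _, he⟩
    obtain ⟨hu, hva⟩ := Prod.mk.inj he
    exact ⟨w, hu, Prod.mk.inj hva⟩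
  · rintro ⟨w, rfl, rfl, rfl⟩
    exact ⟨w, h, rfl⟩

/-- The path of the quotient trellis belonging to a word of `D`. -/
def quotientPath (D' : AddSubgroup (Fin n → A)) (w : D) : (quotient D D').Path where
  vert t _ := quotientState D' t w
  label := w.1
  mem _ h := (mem_quotient_E h).2 ⟨w, rfl, rfl, rfl⟩

lemma exists_prefix_of_quotient_path (hDD : D' ≤ D) (p : (quotient D D').Path) :
    ∀ (t : ℕ) (ht : t ≤ n), ∃ w : D, quotientState D' t w = p.vert t ht ∧
      ∀ i : Fin n, (i : ℕ) < t → w.1 i = p.label i := by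
  intro t
  induction t with
  | zero =>
    intro ht
    exact ⟨0, ((quotient D D').root_unique _).trans ((quotient D D').root_unique _).symm,
      fun i hi => absurd hi (Nat.not_lt_zero _)⟩
  | succ t ih =>
    intro ht
    obtain ⟨w, hw, hwl⟩ := ih (Nat.le_of_succ_le ht)
    obtain ⟨w', h1, h2, h3⟩ := (mem_quotient_E ht).1 (p.mem t ht)
    obtain ⟨x, ⟨hxD, hx⟩, y, ⟨-, hy⟩, hxy⟩ :=
      mem_stateGroup.1 (quotientState_eq_iff.1 (hw.trans h1))
    refine ⟨w' + ⟨x, hDD hxD⟩, ?_, fun i hi => ?_⟩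
    · rw [h2, quotientState_eq_iff, mem_stateGroup]
      exact ⟨x, ⟨hxD, fun i hi => hx i (by omega)⟩, 0, ⟨D.zero_mem, fun _ _ => rfl⟩, by simp⟩
    · rcases Nat.lt_succ_iff_lt_or_eq.1 hi with hi | hi
      · have := congrFun hxy i
        simp only [Pi.add_apply, Pi.sub_apply, hy i hi, add_zero] at this
        simp [this, hwl i hi]
      · subst hi
        simp [hx i le_rfl, h3]

lemma mem_wordsTo_quotient (hDD : D' ≤ D) (g : D) (w : Fin n → A) :
    w ∈ (quotient D D').WordsTo (quotientState D' n g) ↔ w - g.1 ∈ D' := by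
  constructor
  · rintro ⟨p, hp, rfl⟩
    obtain ⟨w, hw, hwl⟩ := exists_prefix_of_quotient_path hDD p n le_rfl
    have : w.1 = p.label := funext fun i => hwl i i.2
    rw [hp, quotientState_eq_iff, stateGroup_last, this] at hw
    exact hw
  · intro h
    have hw : w ∈ D := by simpa using D.add_mem (hDD h) g.2
    refine ⟨quotientPath D' ⟨w, hw⟩, ?_, rfl⟩
    change quotientState D' n ⟨w, hw⟩ = _
    rwa [quotientState_eq_iff, stateGroup_last]

lemma quotient_represents {ι : Type} {Cs : ι → Set (Fin n → A)} (hC : IsCosetFamily D D' Cs) :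
    (quotient D D').Represents Cs := by
  choose g hg using hC.nonempty
  have hgD := fun i => hC.subset i _ (hg i)
  let f : ι → (quotient D D').V n := fun i => quotientState D' n ⟨g i, hgD i⟩
  have hf : ∀ i, (quotient D D').WordsTo (f i) = Cs i := fun i => by
    ext w
    rw [mem_wordsTo_quotient hC.le, hC.mem_iff i _ (hg i)]
  have hbij : Function.Bijective f := by
    refine ⟨fun i j hij => hC.injective ?_, fun v => ?_⟩
    · rw [← hf i, ← hf j, hij]
    · obtain ⟨w, rfl⟩ := quotientState_surjective n v
      obtain ⟨i, hi⟩ := hC.cover w.1 w.2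
      refine ⟨i, quotientState_eq_iff.2 ?_⟩
      rw [stateGroup_last]
      exact (hC.mem_iff i _ hi _).1 (hg i)
  exact ⟨Equiv.ofBijective f hbij, hf⟩

lemma card_quotient_V (t : ℕ) :
    Fintype.card ((quotient D D').V t) = (stateGroup D D' t t).relIndex D := by
  rw [← Nat.card_eq_fintype_card]
  rfl

end Quotient

section Represents

variable {D D' : AddSubgroup (Fin n → A)} {ι : Type} {Cs : ι → Set (Fin n → A)}
  {T : Trellis A n}

lemma Represents.label_mem (hC : IsCosetFamily D D' Cs) (hT : T.Represents Cs) (p : T.Path) :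
    p.label ∈ D := by
  obtain ⟨φ, hφ⟩ := hT
  refine hC.subset (φ.symm (p.vert n le_rfl)) _ ?_
  rw [← hφ]
  exact ⟨p, by simp, rfl⟩

lemma Represents.label_sub_mem (hC : IsCosetFamily D D' Cs) (hT : T.Represents Cs)
    (p q : T.Path) (h : p.vert n le_rfl = q.vert n le_rfl) : p.label - q.label ∈ D' := by
  obtain ⟨φ, hφ⟩ := hT
  have key : ∀ r : T.Path, r.vert n le_rfl = q.vert n le_rfl →
      r.label ∈ Cs (φ.symm (q.vert n le_rfl)) := fun r hr => by
    rw [← hφ]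
    exact ⟨r, by simp [hr], rfl⟩
  exact (hC.mem_iff _ _ (key q rfl) _).1 (key p h)

lemma Represents.exists_path (hC : IsCosetFamily D D' Cs) (hT : T.Represents Cs) (w : D) :
    ∃ p : T.Path, p.label = w := by
  obtain ⟨φ, hφ⟩ := hT
  obtain ⟨i, hi⟩ := hC.cover w.1 w.2
  rw [← hφ] at hi
  obtain ⟨p, -, hp⟩ := hi
  exact ⟨p, hp⟩

lemma Represents.sub_mem_stateGroup (hC : IsCosetFamily D D' Cs) (hT : T.Represents Cs)
    (p q : T.Path) (t : ℕ) (ht : t ≤ n) (h : p.vert t ht = q.vert t ht) :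
    p.label - q.label ∈ stateGroup D D' t t := by
  rcases ht.eq_or_lt with rfl | htn
  · rw [stateGroup_last]
    exact hT.label_sub_mem hC p q h
  · let r : T.Path := p.join q t htn (q.label ⟨t, htn⟩) (by rw [h]; exact q.mem t htn)
    have hrq : r.label - q.label ∈ D' :=
      hT.label_sub_mem hC r q (by simp [r, Path.join, htn])
    have hpr : p.label - r.label ∈ D := D.sub_mem (hT.label_mem hC p) (hT.label_mem hC r)
    refine mem_stateGroup.2 ⟨_, ⟨hrq, fun i hi => ?_⟩, _, ⟨hpr, fun i hi => ?_⟩, by abel⟩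
    · rcases hi.eq_or_lt with hi | hi
      · simp [r, Path.join, hi]
      · simp [r, Path.join, hi.not_gt, hi.ne']
    · simp [r, Path.join, hi]

variable [Finite A]

lemma Represents.injective_vert (hC : IsCosetFamily D D' Cs) (hT : T.Represents Cs)
    (P : D → T.Path) (hP : ∀ w, (P w).label = w) (t : ℕ) (ht : t ≤ n) :
    Function.Injective fun x : (quotient D D').V t =>
      (P (Function.surjInv (quotientState_surjective t) x)).vert t ht := by
  intro x y hxy
  have := hT.sub_mem_stateGroup hC _ _ t ht hxy
  rwa [hP, hP, ← quotientState_eq_iff, Function.surjInv_eq (quotientState_surjective t),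
    Function.surjInv_eq (quotientState_surjective t)] at this

lemma MinimalRep.card_V (hC : IsCosetFamily D D' Cs) (hT : T.MinimalRep Cs) (t : ℕ)
    (ht : t ≤ n) : Fintype.card (T.V t) = (stateGroup D D' t t).relIndex D := by
  choose P hP using hT.1.exists_path hC
  have hle : ∀ t ∈ Finset.range (n + 1),
      Fintype.card ((quotient D D').V t) ≤ Fintype.card (T.V t) := fun t ht =>
    Fintype.card_le_of_injective _
      (hT.1.injective_vert hC P hP t (Nat.lt_succ_iff.1 (Finset.mem_range.1 ht)))
  have hsum := le_antisymm (Finset.sum_le_sum hle) (hT.2 _ (quotient_represents hC))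
  rw [← card_quotient_V]
  exact ((Finset.sum_eq_sum_iff_of_le hle).1 hsum t
    (Finset.mem_range.2 (Nat.lt_succ_iff.2 ht))).symm

lemma MinimalRep.exists_paths_through_every_vertex (hC : IsCosetFamily D D' Cs) (hT : T.MinimalRep Cs) :
    ∃ P : D → T.Path, (∀ w, (P w).label = w) ∧ ∀ (t : ℕ) (ht : t ≤ n) (v : T.V t),
      ∃ w, (P w).vert t ht = v := by
  choose P hP using hT.1.exists_path hC
  refine ⟨P, hP, fun t ht v => ?_⟩
  have hbij := (Fintype.bijective_iff_injective_and_card _).2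
    ⟨hT.1.injective_vert hC P hP t ht, (card_quotient_V t).trans (hT.card_V hC t ht).symm⟩
  obtain ⟨x, hx⟩ := hbij.2 v
  exact ⟨_, hx⟩

lemma MinimalRep.vert_eq (hC : IsCosetFamily D D' Cs) (hT : T.MinimalRep Cs) (p q : T.Path)
    (t : ℕ) (ht : t ≤ n) (h : p.label - q.label ∈ stateGroup D D' t t) :
    p.vert t ht = q.vert t ht := by
  choose P hP using hT.1.exists_path hC
  have hbij := (Fintype.bijective_iff_injective_and_card _).2
    ⟨hT.1.injective_vert hC P hP t ht, (card_quotient_V t).trans (hT.card_V hC t ht).symm⟩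
  have key : ∀ r : T.Path, ∃ x, (P (Function.surjInv (quotientState_surjective t) x)).vert t ht =
      r.vert t ht ∧ x = quotientState D' t ⟨r.label, hT.1.label_mem hC r⟩ := fun r => by
    obtain ⟨x, hx⟩ := hbij.2 (r.vert t ht)
    refine ⟨x, hx, ?_⟩
    have := hT.1.sub_mem_stateGroup hC _ _ t ht hx
    rw [hP] at this
    rw [← Function.surjInv_eq (quotientState_surjective t) x, quotientState_eq_iff]
    exact this
  obtain ⟨x, hx, hx'⟩ := key p
  obtain ⟨y, hy, hy'⟩ := key q
  have hxy : x = y := by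
    rw [hx', hy']
    exact quotientState_eq_iff.2 h
  rw [← hx, ← hy, hxy]

lemma MinimalRep.card_E_le (hC : IsCosetFamily D D' Cs) (hT : T.MinimalRep Cs) (t : ℕ)
    (ht : t < n) : (T.E t).card ≤ (stateGroup D D' t (t + 1)).relIndex D := by
  obtain ⟨P, -, hP⟩ := hT.exists_paths_through_every_vertex hC
  have key : ∀ e : T.E t, ∃ p : T.Path,
      (p.vert t ht.le, p.vert (t + 1) ht, p.label ⟨t, ht⟩) = e.1 := by
    rintro ⟨⟨u, v, a⟩, he⟩
    obtain ⟨w, rfl⟩ := hP t ht.le u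
    obtain ⟨w', rfl⟩ := hP (t + 1) ht v
    exact ⟨(P w).join (P w') t ht a he, by simp [Path.join]⟩
  choose R hR using key
  let f : T.E t → D ⧸ (stateGroup D D' t (t + 1)).addSubgroupOf D :=
    fun e => ((⟨(R e).label, hT.1.label_mem hC _⟩ : D) : _)
  have hf : Function.Injective f := by
    intro e e' h
    have h' : (R e).label - (R e').label ∈ stateGroup D D' t (t + 1) := by
      rw [QuotientAddGroup.eq_iff_sub_mem, AddSubgroup.mem_addSubgroupOf] at h
      exact h
    have h1 := hT.vert_eq hC _ _ t ht.le (stateGroup_mono le_rfl t.le_succ h')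
    have h2 := hT.vert_eq hC _ _ (t + 1) ht (stateGroup_mono t.le_succ le_rfl h')
    have h3 : (R e).label ⟨t, ht⟩ = (R e').label ⟨t, ht⟩ := by
      obtain ⟨x, ⟨-, hx⟩, y, ⟨-, hy⟩, hxy⟩ := mem_stateGroup.1 h'
      have := congrFun hxy ⟨t, ht⟩
      rw [Pi.add_apply, hx _ le_rfl, hy _ (Nat.lt_succ_self t), add_zero, Pi.sub_apply] at this
      exact sub_eq_zero.1 this.symm
    exact Subtype.ext (by rw [← hR e, ← hR e', h1, h2, h3])
  have := Nat.card_le_card_of_injective f hf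
  rwa [Nat.card_eq_fintype_card, Fintype.card_coe] at this

end Represents

end Trellis

section Sums

lemma sum_two_pow_mul_vertices (m r : ℕ) :
    ∑ t ∈ Finset.range (m + r + 1), (2 : ℤ) ^ min t m * 2 ^ min r (m + r - t) =
      2 ^ r * (2 * 2 ^ m - 1) + 2 ^ m * (2 ^ r - 1) := by
  rw [add_right_comm, Finset.sum_range_add]
  congr 1
  · rw [Finset.sum_congr rfl (g := fun t => (2 : ℤ) ^ r * 2 ^ t), ← Finset.mul_sum]
    · rw [show ∑ i ∈ Finset.range (m + 1), (2 : ℤ) ^ i = 2 ^ (m + 1) - 1 by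
        linarith [mul_geom_sum (2 : ℤ) (m + 1)]]
      ring
    · intro t ht
      rw [Finset.mem_range] at ht
      rw [min_eq_left (by omega : t ≤ m), min_eq_left (by omega : r ≤ m + r - t), mul_comm]
  · rw [← Finset.sum_range_reflect,
      Finset.sum_congr rfl (g := fun t => (2 : ℤ) ^ m * 2 ^ t), ← Finset.mul_sum]
    · rw [show ∑ i ∈ Finset.range r, (2 : ℤ) ^ i = 2 ^ r - 1 by
        linarith [mul_geom_sum (2 : ℤ) r]]
    · intro t ht
      rw [Finset.mem_range] at ht
      rw [min_eq_right (by omega), min_eq_right (by omega)]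
      congr 2
      omega

lemma sum_two_pow_mul_edges (m r : ℕ) :
    ∑ t ∈ Finset.range (m + r), (2 : ℤ) ^ min (t + 1) m * 2 ^ min r (m + r - t) =
      2 ^ r * (2 * (2 ^ m - 1)) + 2 ^ m * (2 * (2 ^ r - 1)) := by
  rw [Finset.sum_range_add]
  congr 1
  · rw [Finset.sum_congr rfl (g := fun t => ((2 : ℤ) ^ r * 2) * 2 ^ t), ← Finset.mul_sum]
    · rw [show ∑ i ∈ Finset.range m, (2 : ℤ) ^ i = 2 ^ m - 1 by
        linarith [mul_geom_sum (2 : ℤ) m]]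
      ring
    · intro t ht
      rw [Finset.mem_range] at ht
      rw [min_eq_left (by omega), min_eq_left (by omega), pow_succ]
      ring
  · rw [← Finset.sum_range_reflect,
      Finset.sum_congr rfl (g := fun t => ((2 : ℤ) ^ m * 2) * 2 ^ t), ← Finset.mul_sum]
    · rw [show ∑ i ∈ Finset.range r, (2 : ℤ) ^ i = 2 ^ r - 1 by
        linarith [mul_geom_sum (2 : ℤ) r]]
      ring
    · intro t ht
      rw [Finset.mem_range] at ht
      rw [min_eq_right (by omega), min_eq_right (by omega),
        show m + r - (m + (r - 1 - t)) = t + 1 by omega, pow_succ]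
      ring

/-- The sum `∑ 2 p_{t+1} q_t - ∑ p_t q_t` is monotone in a nondecreasing sequence `p` with fixed
start and a nonincreasing sequence `q` with fixed end. -/
lemma two_mul_sum_sub_sum_le {n : ℕ} {p q a b : ℕ → ℤ} (hq : ∀ t < n, q (t + 1) ≤ q t)
    (ha : ∀ t < n, a t ≤ a (t + 1)) (hq0 : ∀ t ≤ n, 0 ≤ q t) (ha0 : ∀ t ≤ n, 0 ≤ a t)
    (hpa : ∀ t ≤ n, p t ≤ a t) (hqb : ∀ t ≤ n, q t ≤ b t) (hp : p 0 = a 0) (hqn : q n = b n) :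
    2 * ∑ t ∈ Finset.range n, p (t + 1) * q t - ∑ t ∈ Finset.range (n + 1), p t * q t ≤
      2 * ∑ t ∈ Finset.range n, a (t + 1) * b t - ∑ t ∈ Finset.range (n + 1), a t * b t := by
  have h1 : ∀ t ∈ Finset.range n,
      p (t + 1) * (2 * q t - q (t + 1)) ≤ a (t + 1) * (2 * q t - q (t + 1)) := by
    intro t ht
    rw [Finset.mem_range] at ht
    exact mul_le_mul_of_nonneg_right (hpa _ ht) (by linarith [hq t ht, hq0 t ht.le])
  have h2 : ∀ t ∈ Finset.range n,
      q t * (2 * a (t + 1) - a t) ≤ b t * (2 * a (t + 1) - a t) := by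
    intro t ht
    rw [Finset.mem_range] at ht
    exact mul_le_mul_of_nonneg_right (hqb _ ht.le) (by linarith [ha t ht, ha0 (t + 1) ht])
  have expand_left : ∀ x : ℕ → ℤ, ∑ t ∈ Finset.range n, x (t + 1) * (2 * q t - q (t + 1)) =
      2 * ∑ t ∈ Finset.range n, x (t + 1) * q t - ∑ t ∈ Finset.range (n + 1), x t * q t +
        x 0 * q 0 := fun x => by
    rw [Finset.sum_range_succ', Finset.mul_sum, sub_add_eq_sub_sub, sub_add_cancel,
      ← Finset.sum_sub_distrib]
    exact Finset.sum_congr rfl fun t _ => by ring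
  have expand_right : ∀ x : ℕ → ℤ, ∑ t ∈ Finset.range n, x t * (2 * a (t + 1) - a t) =
      2 * ∑ t ∈ Finset.range n, a (t + 1) * x t - ∑ t ∈ Finset.range (n + 1), a t * x t +
        a n * x n := fun x => by
    rw [Finset.sum_range_succ, Finset.mul_sum, sub_add_eq_sub_sub, sub_add_cancel,
      ← Finset.sum_sub_distrib]
    exact Finset.sum_congr rfl fun t _ => by ring
  have h3 := Finset.sum_le_sum h1
  have h4 := Finset.sum_le_sum h2
  rw [expand_left p, expand_left a, hp] at h3
  rw [expand_right q, expand_right b, hqn] at h4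
  linarith

end Sums

/-- **Upper bound on the CSS trellis complexity.**  Let `D' ⊆ D ⊆ 𝔽₂^n` be
binary linear codes with `dim D = (n+k)/2` and `dim D' = (n−k)/2` (the
situation of the X- or Z-part of an `[[n,k]]` CSS code with equally many X- and
Z-stabilizers), so that `D'` has `2^k` cosets in `D`, and let `T` be the
minimal multi-goal trellis over `𝔽₂` representing the joint code whose
underlying code is `D` and whose subcodes are the cosets of `D'` in `D`.  Then
`|V| ≤ 3·2^{(n+k)/2} − 2^k − 1 < 3·2^{(n+k)/2}`,
`|E| ≤ 2·(2^{(n+k)/2+1} − 2^k − 1)` and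
`2|E| − |V| ≤ 5·2^{(n+k)/2} − 3·2^k − 3 < 5·2^{(n+k)/2}`. -/
theorem css_minimal_multigoal_trellis_complexity_bounds
    {n k : ℕ} (hk : k ≤ n) (hpar : Even (n + k))
    (D D' : Submodule (ZMod 2) (Fin n → ZMod 2)) (hDD : D' ≤ D)
    (hDcard : Nat.card D = 2 ^ ((n + k) / 2))
    (hD'card : Nat.card D' = 2 ^ ((n - k) / 2))
    {ι : Type} [Fintype ι] (hι : Fintype.card ι = 2 ^ k)
    (Cs : ι → Set (Fin n → ZMod 2))
    (hCs : ∀ i, ∃ ℓ ∈ D, Cs i = {w | ∃ s ∈ D', w = ℓ + s})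
    (hinj : Function.Injective Cs)
    (hcover : ⋃ i, Cs i = (D : Set (Fin n → ZMod 2)))
    (T : Trellis (ZMod 2) n) (hT : T.MinimalRep Cs) :
    ((T.vertCard : ℤ) ≤ 3 * 2 ^ ((n + k) / 2) - 2 ^ k - 1 ∧
      (T.vertCard : ℤ) < 3 * 2 ^ ((n + k) / 2)) ∧
    (T.edgeCard : ℤ) ≤ 2 * (2 ^ ((n + k) / 2 + 1) - 2 ^ k - 1) ∧
    (2 * (T.edgeCard : ℤ) - (T.vertCard : ℤ) ≤ 5 * 2 ^ ((n + k) / 2) - 3 * 2 ^ k - 3 ∧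
      2 * (T.edgeCard : ℤ) - (T.vertCard : ℤ) < 5 * 2 ^ ((n + k) / 2)) := by
  obtain ⟨r, m, hm, rfl⟩ : ∃ r m, m = r + k ∧ n = m + r := by
    obtain ⟨c, hc⟩ := hpar
    exact ⟨c - k, c, by omega, by omega⟩
  rw [show (m + r + k) / 2 = m by omega] at hDcard ⊢
  rw [show (m + r - k) / 2 = r by omega] at hD'card
  have hC : IsCosetFamily D.toAddSubgroup D'.toAddSubgroup Cs :=
    { le := hDD
      injective := hinj
      nonempty := fun i => by
        obtain ⟨l, -, hl⟩ := hCs i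
        exact ⟨l, by rw [hl]; exact ⟨0, D'.zero_mem, by simp⟩⟩
      subset := fun i w hw => by
        rw [← SetLike.mem_coe, Submodule.coe_toAddSubgroup, ← hcover]
        exact Set.mem_iUnion.2 ⟨i, hw⟩
      mem_iff := fun i w hw w' => by
        obtain ⟨l, -, hl⟩ := hCs i
        rw [hl] at hw ⊢
        obtain ⟨s, hs, rfl⟩ := hw
        constructor
        · rintro ⟨s', hs', rfl⟩
          rw [add_sub_add_left_eq_sub]
          exact D'.sub_mem hs' hs
        · intro h
          exact ⟨w' - (l + s) + s, D'.add_mem h hs, by abel⟩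
      cover := fun w hw => by
        have : w ∈ (D : Set (Fin (m + r) → ZMod 2)) := hw
        rwa [← hcover, Set.mem_iUnion] at this }
  set p : ℕ → ℕ := fun t => (futureWords (ZMod 2) (m + r) t).relIndex D.toAddSubgroup with hp
  set q : ℕ → ℕ := fun t => (pastWords (ZMod 2) (m + r) t).relIndex D'.toAddSubgroup with hq
  have hcardD : Nat.card D.toAddSubgroup = 2 ^ m := hDcard
  have hcardD' : Nat.card D'.toAddSubgroup = 2 ^ r := hD'card
  have hpa : ∀ t ≤ m + r, (p t : ℤ) ≤ 2 ^ min t m := by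
    intro t ht
    have h1 : p t ≤ 2 ^ t := by
      simpa using (relIndex_le_index_of_finite _ _).trans (index_futureWords_le (A := ZMod 2) ht)
    have h2 : p t ≤ 2 ^ m :=
      Nat.le_of_dvd (by positivity) (hcardD ▸ AddSubgroup.relIndex_dvd_card _ _)
    rcases min_choice t m with h | h <;> rw [h] <;> exact_mod_cast ‹_›
  have hqb : ∀ t ≤ m + r, (q t : ℤ) ≤ 2 ^ min r (m + r - t) := by
    intro t ht
    have h1 : q t ≤ 2 ^ (m + r - t) := by
      simpa using (relIndex_le_index_of_finite _ _).trans (index_pastWords_le (A := ZMod 2) ht)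
    have h2 : q t ≤ 2 ^ r :=
      Nat.le_of_dvd (by positivity) (hcardD' ▸ AddSubgroup.relIndex_dvd_card _ _)
    rcases min_choice r (m + r - t) with h | h <;> rw [h] <;> exact_mod_cast ‹_›
  have hqmono : ∀ t < m + r, (q (t + 1) : ℤ) ≤ q t := fun t _ => by
    have := AddSubgroup.isFiniteRelIndex_of_finiteIndex
      (H := pastWords (ZMod 2) (m + r) t) (K := D'.toAddSubgroup)
    have hle : q (t + 1) ≤ q t := AddSubgroup.relIndex_le_of_le_left
      (pastWords_monotone t.le_succ) AddSubgroup.relIndex_ne_zero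
    exact_mod_cast hle
  have hV : (2 : ℤ) ^ r * T.vertCard = ∑ t ∈ Finset.range (m + r + 1), (p t : ℤ) * q t := by
    rw [Trellis.vertCard, Nat.cast_sum, Finset.mul_sum]
    refine Finset.sum_congr rfl fun t ht => ?_
    rw [hT.card_V hC t (Nat.lt_succ_iff.1 (Finset.mem_range.1 ht))]
    have := card_mul_relIndex_stateGroup hC.le (le_refl t)
    rw [hcardD'] at this
    exact_mod_cast this
  have hE : (2 : ℤ) ^ r * T.edgeCard ≤ ∑ t ∈ Finset.range (m + r), (p (t + 1) : ℤ) * q t := by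
    rw [Trellis.edgeCard, Nat.cast_sum, Finset.mul_sum]
    refine Finset.sum_le_sum fun t ht => ?_
    have := card_mul_relIndex_stateGroup hC.le t.le_succ
    rw [hcardD'] at this
    exact_mod_cast (Nat.mul_le_mul_left (2 ^ r)
      (hT.card_E_le hC t (Finset.mem_range.1 ht))).trans this.le
  have hVsum : ∑ t ∈ Finset.range (m + r + 1), (p t : ℤ) * q t ≤
      ∑ t ∈ Finset.range (m + r + 1), (2 : ℤ) ^ min t m * 2 ^ min r (m + r - t) :=
    Finset.sum_le_sum fun t ht => by
      have ht' := Nat.lt_succ_iff.1 (Finset.mem_range.1 ht)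
      exact mul_le_mul (hpa t ht') (hqb t ht') (Nat.cast_nonneg _) (by positivity)
  have hEsum : ∑ t ∈ Finset.range (m + r), (p (t + 1) : ℤ) * q t ≤
      ∑ t ∈ Finset.range (m + r), (2 : ℤ) ^ min (t + 1) m * 2 ^ min r (m + r - t) :=
    Finset.sum_le_sum fun t ht => by
      have ht' := Finset.mem_range.1 ht
      exact mul_le_mul (hpa _ ht') (hqb t ht'.le) (Nat.cast_nonneg _) (by positivity)
  have hEV := two_mul_sum_sub_sum_le (n := m + r) (p := fun t => (p t : ℤ))
    (q := fun t => (q t : ℤ)) (a := fun t => 2 ^ min t m)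
    (b := fun t => 2 ^ min r (m + r - t)) hqmono
    (fun t _ => pow_le_pow_right₀ (by norm_num) (by omega)) (fun _ _ => Nat.cast_nonneg _)
    (fun _ _ => by positivity) hpa hqb (by simp [hp, futureWords_zero])
    (by simp [hq, pastWords_self])
  rw [sum_two_pow_mul_vertices] at hVsum hEV
  rw [sum_two_pow_mul_edges] at hEsum hEV
  have hmk : (2 : ℤ) ^ m = 2 ^ r * 2 ^ k := by rw [hm, pow_add]
  have hrpos : (0 : ℤ) < 2 ^ r := by positivity
  have hkpos : (0 : ℤ) < 2 ^ k := by positivity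
  have bV : (T.vertCard : ℤ) ≤ 3 * 2 ^ m - 2 ^ k - 1 := by
    refine le_of_mul_le_mul_left ?_ hrpos
    rw [hmk] at hVsum ⊢
    linarith
  have bE : (T.edgeCard : ℤ) ≤ 2 * (2 ^ (m + 1) - 2 ^ k - 1) := by
    refine le_of_mul_le_mul_left ?_ hrpos
    rw [pow_succ, hmk]
    rw [hmk] at hEsum
    linarith
  have bEV : 2 * (T.edgeCard : ℤ) - T.vertCard ≤ 5 * 2 ^ m - 3 * 2 ^ k - 3 := by
    refine le_of_mul_le_mul_left ?_ hrpos
    rw [hmk] at hEV ⊢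
    linarith
  exact ⟨⟨bV, by linarith⟩, bE, bEV, by linarith⟩
end

section
/- Let C ⊆ A^n (n > 1) be a rectangular code and let T be a reduced trellis presenting C. If v' and v'' are right twins (or left twins) in some vertex class V_t of T, then the trellis obtained from T by merging v' and v'' (replacing them by a single new vertex that inherits all edges incident to v' or v'') still presents C. Consequently, repeatedly merging twin vertices in any reduced trellis presenting C terminates with the (unique) reduced biproper, hence minimal, trellis of C. -/
namespace Trellis

/-- `T'` is the trellis obtained from `T` by merging the two distinct vertices
`v'` and `v''` of the vertex class `V t`: there are maps `φ s : V s(T) → V s(T')`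
which are bijective away from level `t`, which at level `t` are surjective and
identify exactly `v'` and `v''`, and the edges of `T'` are exactly the images
of the edges of `T` (each edge keeping its label). -/
def IsMergeAt {A : Type} {n : ℕ} (T T' : Trellis A n) (t : ℕ)
    (v' v'' : T.V t) : Prop :=
  ∃ φ : ∀ s, T.V s → T'.V s,
    (∀ s, s ≠ t → Function.Bijective (φ s)) ∧
    Function.Surjective (φ t) ∧
    φ t v' = φ t v'' ∧
    (∀ x y : T.V t, φ t x = φ t y →
      x = y ∨ (x = v' ∧ y = v'') ∨ (x = v'' ∧ y = v')) ∧
    (∀ (s : ℕ) (e' : T'.V s × T'.V (s + 1) × A),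
      e' ∈ T'.E s ↔ ∃ e ∈ T.E s, e' = (φ s e.1, φ (s + 1) e.2.1, e.2.2))

end Trellis

namespace Trellis

variable {A : Type} {n : ℕ}

/-- The word that agrees with `w` before position `s` and with `w'` from position `s` on. -/
def spliceWord (s : ℕ) (w w' : Fin n → A) : Fin n → A :=
  fun i => if (i : ℕ) < s then w i else w' i

/-- A walk defined up to level `s` and a walk defined from level `s` on that meet at level `s`
combine to a path. -/
theorem exists_path_splice {T : Trellis A n} {s : ℕ} (hs : s ≤ n)
    (f g : ∀ k, k ≤ n → T.V k) (l m : Fin n → A) (hfg : f s hs = g s hs)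
    (hf : ∀ k (h : k < n), k < s → (f k h.le, f (k + 1) h, l ⟨k, h⟩) ∈ T.E k)
    (hg : ∀ k (h : k < n), s ≤ k → (g k h.le, g (k + 1) h, m ⟨k, h⟩) ∈ T.E k) :
    ∃ p : T.Path, p.label = spliceWord s l m ∧
      (∀ k (h : k ≤ n), k ≤ s → p.vert k h = f k h) ∧
      ∀ k (h : k ≤ n), s ≤ k → p.vert k h = g k h := by
  refine ⟨⟨fun k h => if k ≤ s then f k h else g k h, spliceWord s l m, ?_⟩, rfl, ?_, ?_⟩
  · intro k h
    rcases lt_or_ge k s with hk | hk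
    · have h1 : k + 1 ≤ s := hk
      simpa [spliceWord, hk, hk.le, h1] using hf k h hk
    · have h1 : ¬ k + 1 ≤ s := by omega
      rcases hk.eq_or_lt with rfl | hk'
      · simpa [spliceWord, hfg] using hg s h le_rfl
      · simpa [spliceWord, hk.not_gt, hk'.not_ge, h1] using hg k h hk
  · intro k h hk
    simp [hk]
  · intro k h hk
    rcases hk.eq_or_lt with rfl | hk'
    · simp [hfg]
    · simp [hk'.not_ge]

/-- Two paths through a common vertex may be exchanged there. -/
theorem spliceWord_mem_words {T : Trellis A n} {s : ℕ} (hs : s ≤ n) (p q : T.Path)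
    (h : p.vert s hs = q.vert s hs) : spliceWord s p.label q.label ∈ T.Words := by
  obtain ⟨r, hr, -⟩ := exists_path_splice hs p.vert q.vert p.label q.label h
    (fun k hk _ => p.mem k hk) (fun k hk _ => q.mem k hk)
  exact ⟨r, hr⟩

/-- Without right twins, a prefix of a word determines the corresponding initial walk. -/
theorem Biproper.vert_eq_of_label_eq_before {T : Trellis A n} (hT : T.Biproper) (p q : T.Path) (s : ℕ)
    (hs : s ≤ n) (h : ∀ i : Fin n, (i : ℕ) < s → p.label i = q.label i) :
    p.vert s hs = q.vert s hs := by
  induction s with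
  | zero => rw [T.root_unique (p.vert 0 hs), T.root_unique (q.vert 0 hs)]
  | succ s ih =>
    have hv := ih (by omega) fun i hi => h i (by omega)
    have hp := p.mem s hs
    rw [hv, h ⟨s, hs⟩ (Nat.lt_succ_self s)] at hp
    exact hT.1 s hs _ _ _ _ hp (q.mem s hs)

/-- Without left twins, a suffix of a word determines the corresponding final walk. -/
theorem Biproper.vert_eq_of_label_eq_from {T : Trellis A n} (hT : T.Biproper) (hg : T.SingleGoal)
    (p q : T.Path) (s : ℕ) (hs : s ≤ n)
    (h : ∀ i : Fin n, s ≤ (i : ℕ) → p.label i = q.label i) :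
    p.vert s hs = q.vert s hs := by
  induction hs using Nat.decreasingInduction with
  | self => exact hg _ _
  | of_succ s hs ih =>
    have hv := ih fun i hi => h i (by omega)
    have hp := p.mem s hs
    rw [hv, h ⟨s, hs⟩ le_rfl] at hp
    exact hT.2 s hs _ _ _ _ hp (q.mem s hs)

theorem minimalFor_of_biproper {T : Trellis A n} {C : Set (Fin n → A)} (hC : T.Presents C)
    (hred : T.Reduced) (hT : T.Biproper) : T.MinimalFor C := by
  refine ⟨hC, fun T' hC' => Finset.sum_le_sum fun s hs => ?_⟩
  have hs : s ≤ n := by simpa [Nat.lt_succ_iff] using hs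
  choose p hp using hred s hs
  have hq : ∀ v, ∃ q : T'.Path, q.label = (p v).label := fun v => by
    have hw : (p v).label ∈ T.Words := ⟨p v, rfl⟩
    rwa [hC.2, ← hC'.2] at hw
  choose q hq using hq
  refine Fintype.card_le_of_injective (fun v => (q v).vert s hs) fun u v huv => ?_
  have hw := spliceWord_mem_words hs (q u) (q v) huv
  rw [hC'.2, ← hC.2, hq, hq] at hw
  obtain ⟨r, hr⟩ := hw
  rw [← hp u, ← hp v,
    ← hT.vert_eq_of_label_eq_before r (p u) s hs fun i hi => by simp [hr, spliceWord, hi],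
    ← hT.vert_eq_of_label_eq_from hC.1 r (p v) s hs fun i hi => by simp [hr, spliceWord, hi.not_gt]]

/-- Right or left twins of a reduced trellis share a past or a future word. -/
theorem exists_paths_of_twins {T : Trellis A n} (hred : T.Reduced) {t : ℕ} (htn : t + 1 ≤ n)
    {v' v'' : T.V (t + 1)}
    (htwin :
      (∃ (u : T.V t) (a : A), (u, v', a) ∈ T.E t ∧ (u, v'', a) ∈ T.E t) ∨
      (t + 2 ≤ n ∧ ∃ (w : T.V (t + 2)) (a : A),
        (v', w, a) ∈ T.E (t + 1) ∧ (v'', w, a) ∈ T.E (t + 1))) :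
    ∃ p q : T.Path, p.vert (t + 1) htn = v' ∧ q.vert (t + 1) htn = v'' ∧
      ((∀ i : Fin n, (i : ℕ) < t + 1 → p.label i = q.label i) ∨
        ∀ i : Fin n, t + 1 ≤ (i : ℕ) → p.label i = q.label i) := by
  rcases htwin with ⟨u, a, h', h''⟩ | ⟨htn', w, a, h', h''⟩
  · obtain ⟨r, hr⟩ := hred t (by omega) u
    have key : ∀ v, (u, v, a) ∈ T.E t → ∃ p : T.Path, p.vert (t + 1) htn = v ∧
        ∀ i : Fin n, (i : ℕ) < t + 1 →
          p.label i = Function.update r.label ⟨t, htn⟩ a i := by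
      intro v hv
      obtain ⟨r', hr'⟩ := hred (t + 1) htn v
      obtain ⟨p, hpl, -, hp⟩ := exists_path_splice htn
        (Function.update r.vert (t + 1) fun _ => v) r'.vert
        (Function.update r.label ⟨t, htn⟩ a) r'.label (by simp [hr'])
        (by
          intro k h hk
          rcases (Nat.lt_succ_iff.mp hk).eq_or_lt with rfl | hk'
          · simpa [hr] using hv
          · have h1 : k ≠ t + 1 := by omega
            have h2 : k + 1 ≠ t + 1 := by omega
            have h3 : (⟨k, h⟩ : Fin n) ≠ ⟨t, htn⟩ := by simpa using hk'.ne
            simpa only [Function.update_of_ne h1, Function.update_of_ne h2,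
              Function.update_of_ne h3] using r.mem k h)
        (fun k h _ => r'.mem k h)
      exact ⟨p, (hp _ _ le_rfl).trans hr', fun i hi => by simp only [hpl, spliceWord, if_pos hi]⟩
    obtain ⟨p, hp, hpl⟩ := key v' h'
    obtain ⟨q, hq, hql⟩ := key v'' h''
    exact ⟨p, q, hp, hq, .inl fun i hi => (hpl i hi).trans (hql i hi).symm⟩
  · obtain ⟨r, hr⟩ := hred (t + 2) htn' w
    have key : ∀ v, (v, w, a) ∈ T.E (t + 1) → ∃ p : T.Path, p.vert (t + 1) htn = v ∧
        ∀ i : Fin n, t + 1 ≤ (i : ℕ) →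
          p.label i = Function.update r.label ⟨t + 1, htn'⟩ a i := by
      intro v hv
      obtain ⟨r', hr'⟩ := hred (t + 1) htn v
      obtain ⟨p, hpl, hp, -⟩ := exists_path_splice htn r'.vert
        (Function.update r.vert (t + 1) fun _ => v) r'.label
        (Function.update r.label ⟨t + 1, htn'⟩ a) (by simp [hr'])
        (fun k h _ => r'.mem k h)
        (by
          intro k h hk
          rcases hk.eq_or_lt with rfl | hk'
          · simpa [hr] using hv
          · have h1 : k ≠ t + 1 := by omega
            have h2 : k + 1 ≠ t + 1 := by omega
            have h3 : (⟨k, h⟩ : Fin n) ≠ ⟨t + 1, htn'⟩ := by simpa using h1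
            simpa only [Function.update_of_ne h1, Function.update_of_ne h2,
              Function.update_of_ne h3] using r.mem k h)
      exact ⟨p, (hp _ _ le_rfl).trans hr',
        fun i hi => by simp only [hpl, spliceWord, if_neg hi.not_gt]⟩
    obtain ⟨p, hp, hpl⟩ := key v' h'
    obtain ⟨q, hq, hql⟩ := key v'' h''
    exact ⟨p, q, hp, hq, .inr fun i hi => (hpl i hi).trans (hql i hi).symm⟩

/-- In a trellis presenting a rectangular code, two vertices which share a past or a future word
have interchangeable pasts. -/
theorem spliceWord_mem_of_rectangular {T : Trellis A n} {C : Set (Fin n → A)}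
    (hrect : Rectangular C) (hC : T.Words = C) {s : ℕ} (hs0 : 1 ≤ s) (hsn : s < n)
    (r' r'' p q : T.Path)
    (hr : (∀ i : Fin n, (i : ℕ) < s → r'.label i = r''.label i) ∨
      ∀ i : Fin n, s ≤ (i : ℕ) → r'.label i = r''.label i)
    (hp : p.vert s hsn.le = r'.vert s hsn.le) (hq : q.vert s hsn.le = r''.vert s hsn.le) :
    spliceWord s p.label q.label ∈ C := by
  subst hC
  rcases hr with hr | hr
  · convert hrect s hs0 hsn _ _ _ (spliceWord_mem_words hsn.le r' p hp.symm)
      (spliceWord_mem_words hsn.le r'' q hq.symm) ⟨p, rfl⟩ ?_ ?_ using 1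
    · ext i
      by_cases hi : (i : ℕ) < s <;> simp [spliceWord, hi]
    · intro i hi
      simpa [spliceWord, hi] using hr i hi
    · intro i hi
      simp [spliceWord, hi.not_gt]
  · convert hrect s hs0 hsn _ _ _ (spliceWord_mem_words hsn.le q r'' hq) ⟨q, rfl⟩
      (spliceWord_mem_words hsn.le p r' hp) ?_ ?_ using 1
    · ext i
      by_cases hi : (i : ℕ) < s <;> simp [spliceWord, hi]
    · intro i hi
      simp [spliceWord, hi]
    · intro i hi
      simpa [spliceWord, hi.not_gt] using (hr i hi).symm

/-- A path of a merged trellis lifts to two paths of the original trellis, one for the part before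
the merged level and one for the part after it. -/
theorem exists_lift {T T' : Trellis A n} (hred : T.Reduced) {t : ℕ} (htn : t + 1 < n)
    (φ : ∀ s, T.V s → T'.V s) (hφ : ∀ s, s ≠ t + 1 → Function.Bijective (φ s))
    (hE : ∀ (s : ℕ) (e' : T'.V s × T'.V (s + 1) × A),
      e' ∈ T'.E s ↔ ∃ e ∈ T.E s, e' = (φ s e.1, φ (s + 1) e.2.1, e.2.2)) (p' : T'.Path)
    (hsurj : Function.Surjective (φ (t + 1))) :
    ∃ p q : T.Path, φ _ (p.vert (t + 1) htn.le) = φ _ (q.vert (t + 1) htn.le) ∧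
      p'.label = spliceWord (t + 1) p.label q.label := by
  have hs : ∀ s, Function.Surjective (φ s) := fun s => by
    by_cases h : s = t + 1
    · subst h; exact hsurj
    · exact (hφ s h).2
  choose ψ hψ using hs
  have hedge : ∀ k (h : k < n), ∃ u v, (u, v, p'.label ⟨k, h⟩) ∈ T.E k ∧
      φ k u = p'.vert k h.le ∧ φ (k + 1) v = p'.vert (k + 1) h := by
    intro k h
    obtain ⟨⟨u, v, a⟩, he, heq⟩ := (hE k _).1 (p'.mem k h)
    simp only [Prod.mk.injEq] at heq
    exact ⟨u, v, heq.2.2 ▸ he, heq.1.symm, heq.2.1.symm⟩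
  have huniq : ∀ k (h : k ≤ n) (u : T.V k), k ≠ t + 1 → φ k u = p'.vert k h →
      u = ψ k (p'.vert k h) := fun k h u hk hu => (hφ k hk).1 (by rw [hu, hψ])
  obtain ⟨u, x, hux, hu, hx⟩ := hedge t (by omega)
  obtain ⟨y, w, hyw, hy, hw⟩ := hedge (t + 1) htn
  obtain ⟨rx, hrx⟩ := hred (t + 1) htn.le x
  obtain ⟨ry, hry⟩ := hred (t + 1) htn.le y
  let f : ∀ z : T.V (t + 1), ∀ k, k ≤ n → T.V k := fun z =>
    Function.update (fun k h => ψ k (p'.vert k h)) (t + 1) fun _ => z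
  have hf : ∀ z k (h : k < n), k ≠ t → k ≠ t + 1 →
      (f z k h.le, f z (k + 1) h, p'.label ⟨k, h⟩) ∈ T.E k := by
    intro z k h h1 h2
    obtain ⟨a, b, hab, ha, hb⟩ := hedge k h
    have h3 : k + 1 ≠ t + 1 := by omega
    rw [huniq k h.le a h2 ha, huniq (k + 1) h b h3 hb] at hab
    simpa only [f, Function.update_of_ne h2, Function.update_of_ne h3] using hab
  obtain ⟨p, hpl, -, hp⟩ := exists_path_splice htn.le (f x) rx.vert p'.label rx.label
    (by simp [f, hrx])
    (by
      intro k h hk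
      by_cases hkt : k = t
      · subst hkt
        rw [huniq k h.le u (by omega) hu] at hux
        simpa [f] using hux
      · exact hf x k h hkt hk.ne)
    (fun k h _ => rx.mem k h)
  obtain ⟨q, hql, hq, -⟩ := exists_path_splice htn.le ry.vert (f y) ry.label p'.label
    (by simp [f, hry])
    (fun k h _ => ry.mem k h)
    (by
      intro k h hk
      by_cases hkt : k = t + 1
      · subst hkt
        rw [huniq _ h w (by omega) hw] at hyw
        simpa [f] using hyw
      · exact hf y k h (by omega) hkt)
  refine ⟨p, q, ?_, ?_⟩
  · rw [hp _ _ le_rfl, hq _ _ le_rfl, hrx, hry, hx, hy]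
  · ext i
    by_cases hi : (i : ℕ) < t + 1 <;> simp [hpl, hql, spliceWord, hi]

theorem IsMergeAt.vertCard_add_one {T T' : Trellis A n} {s : ℕ} {v' v'' : T.V s}
    (hs : s ≤ n) (hne : v' ≠ v'') (h : T.IsMergeAt T' s v' v'') :
    T'.vertCard + 1 = T.vertCard := by
  obtain ⟨φ, hφ, hsurj, heq, hfib, -⟩ := h
  have hmem : s ∈ Finset.range (n + 1) := by simpa [Nat.lt_succ_iff] using hs
  have hcard : Fintype.card (T'.V s) + 1 = Fintype.card (T.V s) := by
    have hb : Function.Bijective fun x : {x : T.V s // x ≠ v''} => φ s x := by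
      constructor
      · rintro ⟨x, hx⟩ ⟨y, hy⟩ hxy
        rcases hfib x y hxy with h | ⟨-, h⟩ | ⟨h, -⟩
        · exact Subtype.ext h
        · exact absurd h hy
        · exact absurd h hx
      · intro z
        obtain ⟨x, rfl⟩ := hsurj z
        by_cases hx : x = v''
        · exact ⟨⟨v', hne⟩, by rw [hx]; exact heq⟩
        · exact ⟨⟨x, hx⟩, rfl⟩
    have h1 := Fintype.card_of_bijective hb
    have h2 : Fintype.card {x : T.V s // x ≠ v''} = Fintype.card (T.V s) - 1 := by
      simp [Fintype.card_subtype_compl]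
    have h3 : 0 < Fintype.card (T.V s) := Fintype.card_pos_iff.2 ⟨v'⟩
    omega
  rw [vertCard, vertCard, ← Finset.add_sum_erase _ _ hmem, ← Finset.add_sum_erase _ _ hmem,
    ← hcard, Finset.sum_congr rfl fun k hk =>
      Fintype.card_of_bijective (hφ k (Finset.ne_of_mem_erase hk))]
  omega

end Trellis

/-- **Merging twin vertices preserves the presented rectangular code.**
Let `C ⊆ A^n` (`n > 1`) be a rectangular code and `T` a reduced trellis
presenting `C`.  If `v'` and `v''` are distinct right twins or left twins in
the vertex class `V_{t+1}` (`t + 1 ≤ n`), then any trellis `T'` obtained from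
`T` by merging `v'` and `v''` still presents `C`; moreover `T'` is again
reduced and has one vertex fewer.  Consequently, repeatedly merging twins
terminates with the reduced biproper—and hence minimal—trellis of `C`:
every reduced biproper trellis presenting `C` is minimal. -/
theorem merge_twins_presents
    {A : Type} [Fintype A] {n : ℕ} (hn : 1 < n)
    (C : Set (Fin n → A)) (hrect : Rectangular C)
    (T : Trellis A n) (hpres : T.Presents C) (hred : T.Reduced)
    (t : ℕ) (htn : t + 1 ≤ n) (v' v'' : T.V (t + 1)) (hne : v' ≠ v'')
    (htwin :
      (∃ (u : T.V t) (a : A), (u, v', a) ∈ T.E t ∧ (u, v'', a) ∈ T.E t) ∨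
      (t + 2 ≤ n ∧ ∃ (w : T.V (t + 2)) (a : A),
        (v', w, a) ∈ T.E (t + 1) ∧ (v'', w, a) ∈ T.E (t + 1))) :
    (∀ T' : Trellis A n, T.IsMergeAt T' (t + 1) v' v'' →
      T'.Presents C ∧ T'.Reduced ∧ T'.vertCard + 1 = T.vertCard) ∧
    (∀ T₀ : Trellis A n, T₀.Presents C → T₀.Reduced → T₀.Biproper →
      T₀.MinimalFor C) := by
  refine ⟨fun T' hmerge => ?_, fun T₀ hC hr hb => Trellis.minimalFor_of_biproper hC hr hb⟩
  have htn' : t + 1 < n := htn.lt_of_ne (by rintro rfl; exact hne (hpres.1 _ _))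
  have hcard := hmerge.vertCard_add_one htn hne
  obtain ⟨φ, hφ, hsurj, heq, hfib, hE⟩ := hmerge
  have hmap : ∀ p : T.Path, ∃ p' : T'.Path, p'.label = p.label ∧
      ∀ k h, p'.vert k h = φ k (p.vert k h) := fun p =>
    ⟨⟨fun k h => φ k (p.vert k h), p.label, fun k h => (hE k _).2 ⟨_, p.mem k h, rfl⟩⟩,
      rfl, fun _ _ => rfl⟩
  refine ⟨⟨fun v w => ?_, ?_⟩, fun k h z => ?_, hcard⟩
  · obtain ⟨v, rfl⟩ := (hφ n htn'.ne').2 v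
    obtain ⟨w, rfl⟩ := (hφ n htn'.ne').2 w
    rw [hpres.1 v w]
  · refine Set.Subset.antisymm ?_ ?_
    · rintro _ ⟨p', rfl⟩
      obtain ⟨p, q, hpq, hl⟩ := Trellis.exists_lift hred htn' φ hφ hE p' hsurj
      obtain ⟨r', r'', hr', hr'', hr⟩ := Trellis.exists_paths_of_twins hred htn htwin
      rw [hl]
      rcases hfib _ _ hpq with h | ⟨hp, hq⟩ | ⟨hp, hq⟩
      · exact hpres.2 ▸ Trellis.spliceWord_mem_words htn p q h
      · exact Trellis.spliceWord_mem_of_rectangular hrect hpres.2 (by omega) htn' r' r'' p q hr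
          (hp.trans hr'.symm) (hq.trans hr''.symm)
      · exact Trellis.spliceWord_mem_of_rectangular hrect hpres.2 (by omega) htn' r'' r' p q
          (hr.imp (fun h i hi => (h i hi).symm) fun h i hi => (h i hi).symm)
          (hp.trans hr''.symm) (hq.trans hr'.symm)
    · rw [← hpres.2]
      rintro _ ⟨p, rfl⟩
      obtain ⟨p', hp', -⟩ := hmap p
      exact ⟨p', hp'⟩
  · have hz : ∃ x, φ k x = z := by
      by_cases hk : k = t + 1
      · subst hk; exact hsurj z
      · exact (hφ k hk).2 z
    obtain ⟨x, rfl⟩ := hz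
    obtain ⟨p, rfl⟩ := hred k h x
    obtain ⟨p', -, hp'⟩ := hmap p
    exact ⟨p', hp' k h⟩
end

section
/- For natural numbers n, k with k ≤ n and n + k even: Σ_{t=0}^{n} 4^{min(t, n+k−t)} = (5·2^{n+k} − 2^{2k} − 1)/3, and Σ_{t=1}^{n} 4^{min(t, n+k−t+1)} = (4/3)·(2^{n+k+1} − 2^{2k} − 1). (These are, respectively, the total number of vertices and the total number of edges of the minimal multi-goal trellis of a maximum-complexity [[n,k]] stabilizer code, whose vertex profile satisfies log_4 |V_t| = min{t, n+k−t}.) -/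
theorem three_mul_sum_four_pow (a d : ℕ) :
    3 * ∑ i ∈ Finset.range d, (4 : ℤ) ^ (a + i) = 4 ^ (a + d) - 4 ^ a := by
  induction d with
  | zero => simp
  | succ d ih =>
    rw [Finset.sum_range_succ, mul_add, ih, ← add_assoc, pow_succ]
    ring

theorem three_mul_sum_four_pow_reflect (a d : ℕ) :
    3 * ∑ i ∈ Finset.range d, (4 : ℤ) ^ (a + (d - 1 - i)) = 4 ^ (a + d) - 4 ^ a := by
  rw [Finset.sum_range_reflect (fun i => (4 : ℤ) ^ (a + i)), three_mul_sum_four_pow]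


/-- **Vertex and edge counts of the maximum-complexity `[[n,k]]` trellis.**
For `k ≤ n` with `n + k` even:
`Σ_{t=0}^{n} 4^{min(t, n+k−t)} = (5·2^{n+k} − 2^{2k} − 1)/3` and
`Σ_{t=1}^{n} 4^{min(t, n+k−t+1)} = (4/3)·(2^{n+k+1} − 2^{2k} − 1)`
(stated multiplied through by `3` to avoid division). -/
theorem mc_code_vertex_edge_count (n k : ℕ) (hk : k ≤ n) (hpar : Even (n + k)) :
    3 * ∑ t ∈ Finset.range (n + 1), (4 : ℤ) ^ min t (n + k - t) =
      5 * 2 ^ (n + k) - 2 ^ (2 * k) - 1 ∧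
    3 * ∑ t ∈ Finset.Icc 1 n, (4 : ℤ) ^ min t (n + k - t + 1) =
      4 * (2 ^ (n + k + 1) - 2 ^ (2 * k) - 1) := by
  obtain ⟨d, rfl⟩ : ∃ d, n = k + d + d := by
    obtain ⟨m, hm⟩ := hpar
    exact ⟨m - k, by omega⟩
  have h_pow (j : ℕ) : (2 : ℤ) ^ (2 * j) = 4 ^ j := by rw [pow_mul]; norm_num
  have h_double : k + d + d + k = 2 * (k + d) := by ring
  rw [h_double, pow_succ, h_pow, h_pow]
  constructor
  · have h_left : ∑ t ∈ Finset.range (k + d + 1), (4 : ℤ) ^ min t (2 * (k + d) - t) =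
        ∑ t ∈ Finset.range (k + d + 1), (4 : ℤ) ^ (0 + t) := by
      refine Finset.sum_congr rfl fun t ht => ?_
      rw [Finset.mem_range] at ht
      congr 1
      omega
    have h_right : ∑ t ∈ Finset.range d,
          (4 : ℤ) ^ min (k + d + 1 + t) (2 * (k + d) - (k + d + 1 + t)) =
        ∑ t ∈ Finset.range d, (4 : ℤ) ^ (k + (d - 1 - t)) := by
      refine Finset.sum_congr rfl fun t ht => ?_
      rw [Finset.mem_range] at ht
      congr 1
      omega
    rw [show k + d + d + 1 = k + d + 1 + d by ring, Finset.sum_range_add, h_left, h_right,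
      mul_add, three_mul_sum_four_pow, three_mul_sum_four_pow_reflect]
    ring
  · have h_left : ∑ t ∈ Finset.range (k + d),
          (4 : ℤ) ^ min (1 + t) (2 * (k + d) - (1 + t) + 1) =
        ∑ t ∈ Finset.range (k + d), (4 : ℤ) ^ (1 + t) := by
      refine Finset.sum_congr rfl fun t ht => ?_
      rw [Finset.mem_range] at ht
      congr 1
      omega
    have h_right : ∑ t ∈ Finset.range d,
          (4 : ℤ) ^ min (1 + (k + d + t)) (2 * (k + d) - (1 + (k + d + t)) + 1) =
        ∑ t ∈ Finset.range d, (4 : ℤ) ^ (k + 1 + (d - 1 - t)) := by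
      refine Finset.sum_congr rfl fun t ht => ?_
      rw [Finset.mem_range] at ht
      congr 1
      omega
    have h_Icc : Finset.Icc 1 (k + d + d) = Finset.Ico 1 (k + d + d + 1) := by
      ext t
      simp only [Finset.mem_Icc, Finset.mem_Ico]
      omega
    rw [h_Icc, Finset.sum_Ico_eq_sum_range, Nat.add_sub_cancel, Finset.sum_range_add, h_left,
      h_right, mul_add, three_mul_sum_four_pow, three_mul_sum_four_pow_reflect]
    ring
end
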